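/- arXiv:2512.16539 — 3 statements merged into one kernel-verified Lean document; each statement's English description precedes it below -/
import Mathlib

section
/- Let A ∈ ℂ^{n×n} be a negative definite Hermitian matrix. Suppose X = (X_1, …, X_k) ∈ ℂ^{n×p} with block sizes p_1 + … + p_k = p satisfies: each X_i ∈ ℂ^{n×p_i} has rank r_i and reduced SVD X_i = U_i Σ_i V_i^* with V_i^*V_i = I and X_i ∈ OB(n, p_i); the matrix U = (U_1, …, U_k) satisfies U*U = I and U*AU is diagonal; writing ã_{ij} for the j-th diagonal entry of U_i^*AU_i, the singular values satisfy σ_{ij} = sqrt(1 + (p_i − r_i)/(ã_{ij} · Σ_{ℓ=1}^{r_i} 1/ã_{iℓ})); whenever the j-th column of U_i is not an eigenvector of A, σ_{ij} = √2; and at most one block X_i has full rank. Then X is a stationary point of qOMM: setting D = diag(d_1 I_{p_1}, …, d_k I_{p_k}) with d_i = 2(p_i − r_i)/(Σ_{j=1}^{r_i} 1/ã_{ij}), one has 2AX − AX(X*X) − X(X*AX) + XD = 0 and X ∈ OB(n,p). -/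
open Matrix Finset

noncomputable section

/-- If `X = U S Wᴴ` with `S = diag s` real, `WᴴW = 1` and `UᴴAU = diag t`, then the stationarity
equation of qOMM for `X` reduces to an equation between the columns of `A U` and `U`. -/
theorem qOMM_gradient_eq_zero_of_factorization {m ι κ : Type*} [Fintype m] [Fintype ι] [Fintype κ]
    [DecidableEq ι] [DecidableEq κ] {A : Matrix m m ℂ} {U : Matrix m ι ℂ} {s t d : ι → ℂ}
    {W : Matrix κ ι ℂ} {D : κ → ℂ} {X : Matrix m κ ℂ}
    (hX : X = U * diagonal s * Wᴴ) (hs : star s = s) (hU : Uᴴ * U = 1) (hW : Wᴴ * W = 1)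
    (ht : Uᴴ * A * U = diagonal t) (hD : Wᴴ * diagonal D = diagonal d * Wᴴ)
    (hcol : A * U * diagonal (fun c => 2 - s c ^ 2) = U * diagonal (fun c => s c ^ 2 * t c - d c)) :
    (2 : ℂ) • (A * X) - A * X * (Xᴴ * X) - X * (Xᴴ * A * X) + X * diagonal D = 0 := by
  have hXH : Xᴴ = W * diagonal s * Uᴴ := by
    simp [hX, conjTranspose_mul, diagonal_conjTranspose, hs, Matrix.mul_assoc]
  have hgram : Xᴴ * X = W * (diagonal s * diagonal s) * Wᴴ := by
    calc Xᴴ * X = W * diagonal s * (Uᴴ * U) * diagonal s * Wᴴ := by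
          rw [hXH, hX]; simp only [Matrix.mul_assoc]
      _ = _ := by rw [hU]; simp only [Matrix.mul_assoc, Matrix.one_mul]
  have henergy : Xᴴ * A * X = W * (diagonal s * diagonal t * diagonal s) * Wᴴ := by
    calc Xᴴ * A * X = W * diagonal s * (Uᴴ * A * U) * diagonal s * Wᴴ := by
          rw [hXH, hX]; simp only [Matrix.mul_assoc]
      _ = _ := by rw [ht]; simp only [Matrix.mul_assoc]
  have hcancel (Y : Matrix m ι ℂ) (Z : Matrix ι ι ℂ) :
      Y * Wᴴ * (W * Z * Wᴴ) = Y * Z * Wᴴ := by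
    calc Y * Wᴴ * (W * Z * Wᴴ) = Y * (Wᴴ * W) * Z * Wᴴ := by simp only [Matrix.mul_assoc]
      _ = _ := by rw [hW, Matrix.mul_one]
  have hfactor : (2 : ℂ) • (A * X) - A * X * (Xᴴ * X) - X * (Xᴴ * A * X) + X * diagonal D =
      (A * U * diagonal (fun c => 2 - s c ^ 2) - U * diagonal (fun c => s c ^ 2 * t c - d c))
        * diagonal s * Wᴴ := by
    have hAX : A * X = A * U * diagonal s * Wᴴ := by rw [hX]; simp only [Matrix.mul_assoc]
    have hXD : X * diagonal D = U * diagonal s * diagonal d * Wᴴ := by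
      rw [hX, Matrix.mul_assoc, hD]; simp only [Matrix.mul_assoc]
    rw [hgram, henergy, hXD, hAX, hcancel, hX, hcancel, ← Matrix.smul_mul, ← Matrix.sub_mul,
      ← Matrix.sub_mul, ← Matrix.add_mul]
    congr 1
    ext a c
    simp only [diagonal_mul_diagonal, Matrix.mul_assoc U, Matrix.sub_apply, Matrix.add_apply,
      Matrix.smul_apply, mul_diagonal, smul_eq_mul]
    ring
  rw [hfactor, hcol, sub_self, Matrix.zero_mul, Matrix.zero_mul]

/-- Blockwise factorizations `X i = U i * S i * (V i)ᴴ` assemble to a factorization of the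
horizontally concatenated matrix. -/
theorem concat_eq_mul_diagonal_mul_blockDiagonal' {m o : Type*} [Fintype o] [DecidableEq o]
    {ρ π : o → Type*} [∀ i, Fintype (ρ i)] [∀ i, DecidableEq (ρ i)]
    (U : ∀ i, Matrix m (ρ i) ℂ) (s : ∀ i, ρ i → ℂ) (V : ∀ i, Matrix (π i) (ρ i) ℂ) :
    (of fun a (c : Σ i, π i) => (U c.1 * diagonal (s c.1) * (V c.1)ᴴ) a c.2) =
      (of fun a (c : Σ i, ρ i) => U c.1 a c.2) * diagonal (fun c : Σ i, ρ i => s c.1 c.2) *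
        (blockDiagonal' V)ᴴ := by
  ext a ⟨i, b⟩
  rw [of_apply, Matrix.mul_apply, Matrix.mul_apply, Fintype.sum_sigma, Finset.sum_eq_single i]
  · refine Finset.sum_congr rfl fun l _ => ?_
    rw [mul_diagonal, mul_diagonal, conjTranspose_apply, conjTranspose_apply,
      blockDiagonal'_apply_eq, of_apply]
  · intro j _ hj
    refine Finset.sum_eq_zero fun l _ => ?_
    rw [conjTranspose_apply, blockDiagonal'_apply_ne _ _ _ hj.symm, star_zero, mul_zero]
  · simp

theorem blockDiagonal'_conjTranspose_mul_diagonal_const {o : Type*} [Fintype o] [DecidableEq o]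
    {ρ π : o → Type*} [∀ i, Fintype (ρ i)] [∀ i, DecidableEq (ρ i)]
    [∀ i, Fintype (π i)] [∀ i, DecidableEq (π i)]
    (V : ∀ i, Matrix (π i) (ρ i) ℂ) (d : o → ℂ) :
    (blockDiagonal' V)ᴴ * diagonal (fun c : Σ i, π i => d c.1) =
      diagonal (fun c : Σ i, ρ i => d c.1) * (blockDiagonal' V)ᴴ := by
  ext ⟨i, a⟩ ⟨j, b⟩
  rw [mul_diagonal, diagonal_mul, conjTranspose_apply]
  by_cases h : j = i
  · subst h
    exact mul_comm _ _
  · rw [blockDiagonal'_apply_ne _ _ _ h, star_zero, zero_mul, mul_zero]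

/-- converse direction for qOMM stationary points.  If a block matrix
`X = (X_1, …, X_k)` (with columns indexed by `Σ i, Fin (pp i)`, block sizes summing to
`p`) satisfies the structural conditions of the stationary point theorem, then it is a
stationary point of qOMM: with `D = diag(d_1 I_{p_1}, …, d_k I_{p_k})`,
`d_i = 2(p_i − r_i)/(Σ_j 1/ã_{ij})`, one has
`2AX − AX(X*X) − X(X*AX) + XD = 0` and `X ∈ OB(n,p)`. -/
theorem qOMM_stationary_structure_converse {n : ℕ}
    (A : Matrix (Fin n) (Fin n) ℂ) (hA : A.IsHermitian)
    (hneg : ∀ z : Fin n → ℂ, z ≠ 0 → (star z ⬝ᵥ A.mulVec z).re < 0)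
    (k : ℕ) (hk : 0 < k) (pp r : Fin k → ℕ)
    (hpp : ∀ i, 0 < pp i) (hr : ∀ i, r i ≤ pp i)
    (U : (i : Fin k) → Matrix (Fin n) (Fin (r i)) ℂ)
    (σ : (i : Fin k) → Fin (r i) → ℝ)
    (V : (i : Fin k) → Matrix (Fin (pp i)) (Fin (r i)) ℂ)
    (X : (i : Fin k) → Matrix (Fin n) (Fin (pp i)) ℂ)
    (hX : ∀ i, X i = U i * Matrix.diagonal (fun j => (σ i j : ℂ)) * (V i)ᴴ)
    (hrank : ∀ i, (X i).rank = r i)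
    (hσpos : ∀ i (j : Fin (r i)), 0 < σ i j)
    (hV : ∀ i, (V i)ᴴ * V i = 1)
    (hOBi : ∀ i j, ((X i)ᴴ * X i) j j = 1)
    (Uc : Matrix (Fin n) (Σ i : Fin k, Fin (r i)) ℂ)
    (hUc : ∀ (a : Fin n) (c : Σ i : Fin k, Fin (r i)), Uc a c = U c.1 a c.2)
    (hUcU : Ucᴴ * Uc = 1)
    (hUdiag : (Ucᴴ * A * Uc).IsDiag)
    (hσ : ∀ i (j : Fin (r i)), σ i j =
      Real.sqrt (1 + ((pp i : ℝ) - (r i : ℝ)) /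
        ((((U i)ᴴ * A * U i) j j).re *
          ∑ l : Fin (r i), 1 / (((U i)ᴴ * A * U i) l l).re)))
    (hσ2 : ∀ i (j : Fin (r i)),
      (¬ ∃ c : ℂ, A.mulVec (fun a => U i a j) = c • (fun a => U i a j)) →
      σ i j = Real.sqrt 2)
    (hfull : ∀ i i', r i = pp i → r i' = pp i' → i = i')
    (Xc : Matrix (Fin n) (Σ i : Fin k, Fin (pp i)) ℂ)
    (hXc : ∀ (a : Fin n) (c : Σ i : Fin k, Fin (pp i)), Xc a c = X c.1 a c.2) :
    (2 : ℂ) • (A * Xc) - A * Xc * (Xcᴴ * Xc) - Xc * (Xcᴴ * A * Xc)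
      + Xc * Matrix.diagonal (fun c : Σ i : Fin k, Fin (pp i) =>
          ((2 * ((pp c.1 : ℝ) - (r c.1 : ℝ)) /
            (∑ j : Fin (r c.1), 1 / (((U c.1)ᴴ * A * U c.1) j j).re) : ℝ) : ℂ)) = 0 ∧
    ∀ c, (Xcᴴ * Xc) c c = 1 := by
  set W := blockDiagonal' V with hWdef
  set α : ∀ i, Fin (r i) → ℝ := fun i j => (((U i)ᴴ * A * U i) j j).re
  set τ : Fin k → ℝ := fun i => ∑ j, 1 / α i j
  set d : Fin k → ℝ := fun i => 2 * ((pp i : ℝ) - (r i : ℝ)) / τ i with hd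
  have hUc_eq : Uc = of fun a (c : Σ i, Fin (r i)) => U c.1 a c.2 := by
    ext a c; exact hUc a c
  have hfact : Xc = Uc * diagonal (fun c : Σ i, Fin (r i) => (σ c.1 c.2 : ℂ)) * Wᴴ := by
    rw [hUc_eq, hWdef, ← concat_eq_mul_diagonal_mul_blockDiagonal' U (fun i j => (σ i j : ℂ)) V]
    ext a c
    rw [hXc, hX, of_apply]
  have hW : Wᴴ * W = 1 := by
    rw [hWdef, blockDiagonal'_conjTranspose, ← blockDiagonal'_mul]
    simp only [hV]
    exact blockDiagonal'_one
  have hentry (c : Σ i, Fin (r i)) :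
      (Ucᴴ * A * Uc) c c = ((U c.1)ᴴ * A * U c.1) c.2 c.2 := by
    simp [Matrix.mul_apply, hUc]
  have hreal (c : Σ i, Fin (r i)) : (Ucᴴ * A * Uc) c c = (α c.1 c.2 : ℂ) := by
    have h : α c.1 c.2 = ((Ucᴴ * A * Uc) c c).re := by rw [hentry]
    rw [h]
    exact ((isHermitian_conjTranspose_mul_mul Uc hA).coe_re_apply_self c).symm
  have hT : Ucᴴ * A * Uc = diagonal (fun c : Σ i, Fin (r i) => (α c.1 c.2 : ℂ)) := by
    rw [← hUdiag.diagonal_diag]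
    congr 1
    ext c
    exact hreal c
  have hquad (c : Σ i, Fin (r i)) :
      star (Uc.col c) ⬝ᵥ A *ᵥ Uc.col c = (α c.1 c.2 : ℂ) := by
    rw [← hreal, Matrix.mul_assoc]
    rfl
  have hnorm (c : Σ i, Fin (r i)) : star (Uc.col c) ⬝ᵥ Uc.col c = 1 := by
    have h := congrFun (congrFun hUcU c) c
    rwa [one_apply_eq] at h
  have hαneg (i : Fin k) (j : Fin (r i)) : α i j < 0 := by
    have hne : Uc.col ⟨i, j⟩ ≠ 0 := by
      intro h0
      simpa [h0] using hnorm ⟨i, j⟩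
    simpa [hquad] using hneg _ hne
  have hsq (i : Fin k) (j : Fin (r i)) : 2 * α i j * (σ i j ^ 2 - 1) = d i := by
    have hτneg : τ i < 0 :=
      Finset.sum_neg (fun l _ => one_div_neg.mpr (hαneg i l)) ⟨j, Finset.mem_univ j⟩
    have hpr : (0 : ℝ) ≤ (pp i : ℝ) - r i := sub_nonneg.mpr (by exact_mod_cast hr i)
    have hnn : 0 ≤ 1 + ((pp i : ℝ) - r i) / (α i j * τ i) :=
      add_nonneg zero_le_one (div_nonneg hpr (mul_pos_of_neg_of_neg (hαneg i j) hτneg).le)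
    have h : σ i j ^ 2 = 1 + ((pp i : ℝ) - r i) / (α i j * τ i) := by
      rw [hσ i j]
      exact Real.sq_sqrt hnn
    have h1 := (hαneg i j).ne
    have h2 := hτneg.ne
    rw [h, hd]
    field_simp
    ring
  have hcol : A * Uc * diagonal (fun c : Σ i, Fin (r i) => 2 - (σ c.1 c.2 : ℂ) ^ 2) =
      Uc * diagonal (fun c : Σ i, Fin (r i) => (σ c.1 c.2 : ℂ) ^ 2 * (α c.1 c.2 : ℂ) - (d c.1 : ℂ)) := by
    ext a ⟨i, j⟩
    rw [mul_diagonal, mul_diagonal]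
    have hcolU : Uc.col ⟨i, j⟩ = fun a => U i a j := by ext a; exact hUc a ⟨i, j⟩
    have hsqC : 2 * (α i j : ℂ) * ((σ i j : ℂ) ^ 2 - 1) = (d i : ℂ) := by exact_mod_cast hsq i j
    by_cases hev : ∃ c : ℂ, A.mulVec (fun a => U i a j) = c • (fun a => U i a j)
    · obtain ⟨c, hc⟩ := hev
      rw [← hcolU] at hc
      have hcα : c = (α i j : ℂ) := by
        have h := hquad ⟨i, j⟩
        rwa [hc, dotProduct_smul, hnorm, smul_eq_mul, mul_one] at h
      have hAU : (A * Uc) a ⟨i, j⟩ = (α i j : ℂ) * Uc a ⟨i, j⟩ := by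
        rw [← hcα]
        exact congrFun hc a
      rw [hAU, ← hsqC]
      ring
    · have h2 : (σ i j : ℂ) ^ 2 = 2 := by
        have h : σ i j ^ 2 = 2 := by rw [hσ2 i j hev]; exact Real.sq_sqrt zero_le_two
        exact_mod_cast h
      rw [← hsqC, h2]
      ring
  refine ⟨?_, fun c => ?_⟩
  · refine qOMM_gradient_eq_zero_of_factorization hfact ?_ hUcU hW hT
      (blockDiagonal'_conjTranspose_mul_diagonal_const V fun i => (d i : ℂ)) hcol
    ext c
    exact Complex.conj_ofReal _
  · rw [← hOBi c.1 c.2]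
    simp [Matrix.mul_apply, hXc]
end
end

section
/- Let A ∈ ℂ^{n×n} be a negative definite Hermitian matrix and p ≤ n. If X ∈ OB(n,p) is a local minimizer of E0(X) = tr((2I − X*X)(X*AX)) over OB(n,p), then there exist a matrix Q_p ∈ ℂ^{n×p} whose columns are orthonormal eigenvectors of A corresponding to the p smallest eigenvalues of A (counted with multiplicity) and a unitary matrix V ∈ ℂ^{p×p} such that X = Q_p V^*. -/
open Matrix Finset

noncomputable section

/-- The oblique manifold `OB(n,p)`: complex `n × p` matrices all of whose columns have
unit norm, i.e. every diagonal entry of `Xᴴ * X` equals `1`. -/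
def OBset (n p : ℕ) : Set (Matrix (Fin n) (Fin p) ℂ) :=
  {X | ∀ j, (Xᴴ * X) j j = 1}

/-- Frobenius norm of a complex matrix. -/
def frobNorm {n p : ℕ} (X : Matrix (Fin n) (Fin p) ℂ) : ℝ :=
  Real.sqrt (∑ i, ∑ j, Complex.normSq (X i j))

/-- The eigenvalues of a Hermitian matrix, listed in nondecreasing order
(counted with multiplicity). -/
def sortedEig {n : ℕ} {A : Matrix (Fin n) (Fin n) ℂ} (hA : A.IsHermitian) : Fin n → ℝ :=
  fun i => hA.eigenvalues (Tuple.sort hA.eigenvalues i)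

/-- The qOMM objective `E0(X) = tr((2I − X*X)(X*AX))` (a real number since `A` is Hermitian). -/
def E0 {n p : ℕ} (A : Matrix (Fin n) (Fin n) ℂ) (X : Matrix (Fin n) (Fin p) ℂ) : ℝ :=
  ((((2 : ℂ) • (1 : Matrix (Fin p) (Fin p) ℂ)) - Xᴴ * X) * (Xᴴ * A * X)).trace.re

/-- The Euclidean gradient of `E0` at `X`, up to a factor `2`, is `gradOp A X * X`. -/
def gradOp {n p : ℕ} (A : Matrix (Fin n) (Fin n) ℂ) (X : Matrix (Fin n) (Fin p) ℂ) :
    Matrix (Fin n) (Fin n) ℂ :=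
  (2 : ℂ) • A - A * (X * Xᴴ) - X * Xᴴ * A

/-- The first variation of `X * Xᴴ` in the direction `R`. -/
def gramVar {n p : ℕ} (X R : Matrix (Fin n) (Fin p) ℂ) : Matrix (Fin n) (Fin n) ℂ :=
  X * Rᴴ + R * Xᴴ

theorem re_trace_conjTranspose {m : ℕ} (M : Matrix (Fin m) (Fin m) ℂ) :
    (Mᴴ).trace.re = M.trace.re := by
  rw [Matrix.trace_conjTranspose]; simp

theorem gradOp_isHermitian {n p : ℕ} {A : Matrix (Fin n) (Fin n) ℂ} (hA : A.IsHermitian)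
    (X : Matrix (Fin n) (Fin p) ℂ) : (gradOp A X)ᴴ = gradOp A X := by
  unfold gradOp
  simp only [conjTranspose_sub, conjTranspose_smul, conjTranspose_mul, conjTranspose_conjTranspose,
    hA.eq, RCLike.star_def, map_ofNat]
  abel

theorem E0_eq {n p : ℕ} (A : Matrix (Fin n) (Fin n) ℂ) (X : Matrix (Fin n) (Fin p) ℂ) :
    E0 A X = (A * ((2 : ℂ) • (X * Xᴴ) - X * Xᴴ * (X * Xᴴ))).trace.re := by
  unfold E0
  congr 1
  simp only [Matrix.sub_mul, Matrix.mul_sub, Matrix.trace_sub, Matrix.smul_mul, Matrix.mul_smul,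
    Matrix.trace_smul, Matrix.one_mul]
  congr 1
  · rw [Matrix.trace_mul_comm, ← Matrix.mul_assoc, Matrix.trace_mul_comm]
  · rw [show Xᴴ * X * (Xᴴ * A * X) = (Xᴴ * X * Xᴴ) * (A * X) by simp only [Matrix.mul_assoc],
      Matrix.trace_mul_comm]
    simp only [Matrix.mul_assoc]

theorem E0_add_smul {n p : ℕ} {A : Matrix (Fin n) (Fin n) ℂ} (hA : A.IsHermitian)
    (X R : Matrix (Fin n) (Fin p) ℂ) (t : ℝ) :
    E0 A (X + (t : ℂ) • R) = E0 A X + t * (2 * (Rᴴ * (gradOp A X * X)).trace.re) +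
      t ^ 2 * ((Rᴴ * (gradOp A X * R)).trace.re -
        (A * ((gramVar X R + (t : ℂ) • (R * Rᴴ)) * (gramVar X R + (t : ℂ) • (R * Rᴴ)))).trace.re) := by
  have h1 : (X + (t : ℂ) • R) * (X + (t : ℂ) • R)ᴴ =
      X * Xᴴ + (t : ℂ) • (gramVar X R + (t : ℂ) • (R * Rᴴ)) := by
    simp only [gramVar, conjTranspose_add, conjTranspose_smul, Matrix.add_mul, Matrix.mul_add,
      Matrix.smul_mul, Matrix.mul_smul, smul_add, RCLike.star_def, Complex.conj_ofReal]
    abel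
  have key : ∀ M D : Matrix (Fin n) (Fin n) ℂ,
      (A * ((2 : ℂ) • (M + D) - (M + D) * (M + D))).trace =
      (A * ((2 : ℂ) • M - M * M)).trace + (((2 : ℂ) • A - A * M - M * A) * D).trace -
        (A * (D * D)).trace := by
    intro M D
    have h := Matrix.trace_mul_comm (A * D) M
    simp only [Matrix.sub_mul, Matrix.mul_sub, Matrix.mul_add, Matrix.add_mul, Matrix.trace_sub,
      Matrix.trace_add, Matrix.smul_mul, Matrix.mul_smul, Matrix.trace_smul, smul_add,
      Matrix.mul_assoc, smul_eq_mul] at h ⊢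
    rw [h]; ring
  have hN : (gradOp A X * gramVar X R).trace.re = 2 * (Rᴴ * (gradOp A X * X)).trace.re := by
    have e1 : (gradOp A X * (X * Rᴴ)).trace = (Rᴴ * (gradOp A X * X)).trace := by
      rw [← Matrix.mul_assoc, Matrix.trace_mul_comm]
    have e2 : (gradOp A X * (R * Xᴴ)).trace.re = (Rᴴ * (gradOp A X * X)).trace.re := by
      rw [← re_trace_conjTranspose (Rᴴ * (gradOp A X * X)), conjTranspose_mul, conjTranspose_mul,
        gradOp_isHermitian hA, conjTranspose_conjTranspose, ← Matrix.mul_assoc,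
        Matrix.trace_mul_comm, Matrix.mul_assoc, ← Matrix.mul_assoc, Matrix.trace_mul_comm]
    rw [gramVar, Matrix.mul_add, Matrix.trace_add, Complex.add_re, e1, e2]; ring
  have hP : (gradOp A X * (R * Rᴴ)).trace = (Rᴴ * (gradOp A X * R)).trace := by
    rw [← Matrix.mul_assoc, Matrix.trace_mul_comm]
  rw [E0_eq, h1, key, E0_eq, ← hN, ← hP]
  rw [show (2 : ℂ) • A - A * (X * Xᴴ) - X * Xᴴ * A = gradOp A X from rfl]
  simp only [Matrix.mul_smul, Matrix.smul_mul, Matrix.trace_smul, Matrix.mul_add (gradOp A X),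
    Matrix.trace_add (gradOp A X * _), smul_eq_mul, Complex.sub_re, Complex.add_re,
    Complex.re_ofReal_mul]
  ring

/-- A direction `curveDir X Z t` close to `Z` such that `X + t • curveDir X Z t` stays on the
oblique manifold when `Z` is tangent at `X`. -/
def curveDir {n p : ℕ} (X Z : Matrix (Fin n) (Fin p) ℂ) (t : ℝ) : Matrix (Fin n) (Fin p) ℂ :=
  X * diagonal (fun j => ((-(t * ((Zᴴ * Z) j j).re / 2) /
      (1 + t ^ 2 * ((Zᴴ * Z) j j).re / 4) : ℝ) : ℂ)) +
    Z * diagonal (fun j => ((1 / (1 + t ^ 2 * ((Zᴴ * Z) j j).re / 4) : ℝ) : ℂ))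

theorem conjTranspose_mul_self_apply_eq {n p : ℕ} (Z : Matrix (Fin n) (Fin p) ℂ) (j : Fin p) :
    (Zᴴ * Z) j j = ((∑ i, Complex.normSq (Z i j) : ℝ) : ℂ) := by
  simp [Matrix.mul_apply, Complex.normSq_eq_conj_mul_self]

theorem conjTranspose_mul_self_re_nonneg {n p : ℕ} (Z : Matrix (Fin n) (Fin p) ℂ) (j : Fin p) :
    0 ≤ ((Zᴴ * Z) j j).re := by
  rw [conjTranspose_mul_self_apply_eq, Complex.ofReal_re]
  exact Finset.sum_nonneg fun i _ => Complex.normSq_nonneg _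

theorem trace_conjTranspose_mul_self_eq {n p : ℕ} (Z : Matrix (Fin n) (Fin p) ℂ) :
    (Zᴴ * Z).trace.re = ∑ j, ∑ i, Complex.normSq (Z i j) := by
  simp only [Matrix.trace, Matrix.diag_apply, Complex.re_sum, conjTranspose_mul_self_apply_eq,
    Complex.ofReal_re]

theorem eq_zero_of_trace_conjTranspose_mul_self_nonpos {n p : ℕ} {Z : Matrix (Fin n) (Fin p) ℂ}
    (h : (Zᴴ * Z).trace.re ≤ 0) : Z = 0 := by
  rw [trace_conjTranspose_mul_self_eq] at h
  ext i j
  refine Complex.normSq_eq_zero.1 (le_antisymm (le_trans ?_ h) (Complex.normSq_nonneg _))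
  exact (Finset.single_le_sum (f := fun i => Complex.normSq (Z i j))
      (fun _ _ => Complex.normSq_nonneg _) (Finset.mem_univ i)).trans
    (Finset.single_le_sum (f := fun j => ∑ i, Complex.normSq (Z i j))
      (fun _ _ => Finset.sum_nonneg fun _ _ => Complex.normSq_nonneg _) (Finset.mem_univ j))

theorem curveDir_denom_pos {n p : ℕ} (Z : Matrix (Fin n) (Fin p) ℂ) (t : ℝ) (j : Fin p) :
    0 < 1 + t ^ 2 * ((Zᴴ * Z) j j).re / 4 := by
  have := conjTranspose_mul_self_re_nonneg Z j
  positivity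

theorem curveDir_zero {n p : ℕ} (X Z : Matrix (Fin n) (Fin p) ℂ) : curveDir X Z 0 = Z := by
  simp [curveDir]

theorem continuous_curveDir {n p : ℕ} (X Z : Matrix (Fin n) (Fin p) ℂ) :
    Continuous (curveDir X Z) := by
  unfold curveDir
  refine (continuous_const.matrix_mul (Continuous.matrix_diagonal (continuous_pi fun j => ?_))).add
    (continuous_const.matrix_mul (Continuous.matrix_diagonal (continuous_pi fun j => ?_)))
  · refine Complex.continuous_ofReal.comp (Continuous.div (by fun_prop) (by fun_prop)
      fun t => (curveDir_denom_pos Z t j).ne')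
  · refine Complex.continuous_ofReal.comp (Continuous.div (by fun_prop) (by fun_prop)
      fun t => (curveDir_denom_pos Z t j).ne')

theorem add_smul_curveDir_mem {n p : ℕ} {X Z : Matrix (Fin n) (Fin p) ℂ} (hX : X ∈ OBset n p)
    (hZ : ∀ j, ((Xᴴ * Z) j j).re = 0) (t : ℝ) : X + (t : ℂ) • curveDir X Z t ∈ OBset n p := by
  intro j
  have hpos := curveDir_denom_pos Z t j
  set q := ((Zᴴ * Z) j j).re with hq
  have hqc : (Zᴴ * Z) j j = (q : ℂ) := by
    rw [hq, conjTranspose_mul_self_apply_eq, Complex.ofReal_re]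
  set a : ℝ := -(t * q / 2) / (1 + t ^ 2 * q / 4) with ha
  set b : ℝ := 1 / (1 + t ^ 2 * q / 4) with hb
  have hcol : ∀ i, (X + (t : ℂ) • curveDir X Z t) i j =
      ((1 + t * a : ℝ) : ℂ) * X i j + ((t * b : ℝ) : ℂ) * Z i j := by
    intro i
    simp only [curveDir, Matrix.add_apply, Matrix.smul_apply, Matrix.mul_diagonal, smul_eq_mul]
    rw [← hq, ← ha, ← hb]; push_cast; ring
  have hcross : (Xᴴ * Z) j j + (Zᴴ * X) j j = 0 := by
    have : (Zᴴ * X) j j = star ((Xᴴ * Z) j j) := by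
      rw [← Matrix.conjTranspose_apply, conjTranspose_mul, conjTranspose_conjTranspose]
    rw [this]
    apply Complex.ext <;> simp [hZ j]
  have hXj := hX j
  have expand : ((X + (t : ℂ) • curveDir X Z t)ᴴ * (X + (t : ℂ) • curveDir X Z t)) j j =
      ((1 + t * a : ℝ) : ℂ) ^ 2 * (Xᴴ * X) j j +
      ((1 + t * a : ℝ) : ℂ) * ((t * b : ℝ) : ℂ) * ((Xᴴ * Z) j j + (Zᴴ * X) j j) +
      ((t * b : ℝ) : ℂ) ^ 2 * (Zᴴ * Z) j j := by
    simp only [Matrix.mul_apply, conjTranspose_apply, hcol, Finset.mul_sum,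
      ← Finset.sum_add_distrib]
    refine Finset.sum_congr rfl fun i _ => ?_
    simp only [star_add, star_mul', RCLike.star_def, Complex.conj_ofReal]
    ring
  rw [expand, hcross, hXj, hqc]
  have : (1 + t * a) ^ 2 + (t * b) ^ 2 * q = 1 := by
    have hd : 4 + t ^ 2 * q ≠ 0 := by linarith
    have ha' : a = -(2 * t * q) / (4 + t ^ 2 * q) := by rw [ha]; field_simp; ring
    have hb' : b = 4 / (4 + t ^ 2 * q) := by rw [hb]; field_simp
    rw [ha', hb']; field_simp; ring
  have h2 : (((1 + t * a) ^ 2 + (t * b) ^ 2 * q : ℝ) : ℂ) = 1 := by rw [this]; simp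
  push_cast at h2 ⊢
  linear_combination h2

theorem continuous_frobNorm {n p : ℕ} :
    Continuous (frobNorm : Matrix (Fin n) (Fin p) ℂ → ℝ) := by
  unfold frobNorm
  refine Real.continuous_sqrt.comp (continuous_finsetSum _ fun i _ => continuous_finsetSum _
    fun j _ => Complex.continuous_normSq.comp (continuous_id.matrix_elem i j))

/-- `X` is a local minimizer of `E0 A` over the oblique manifold. -/
def IsLocMin {n p : ℕ} (A : Matrix (Fin n) (Fin n) ℂ) (X : Matrix (Fin n) (Fin p) ℂ) : Prop :=
  X ∈ OBset n p ∧ ∃ δ > (0 : ℝ), ∀ Y ∈ OBset n p, frobNorm (Y - X) < δ → E0 A X ≤ E0 A Y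

theorem IsLocMin.eventually_le {n p : ℕ} {A : Matrix (Fin n) (Fin n) ℂ}
    {X Z : Matrix (Fin n) (Fin p) ℂ} (h : IsLocMin A X) (hZ : ∀ j, ((Xᴴ * Z) j j).re = 0) :
    ∀ᶠ t : ℝ in nhdsWithin 0 (Set.Ioi 0),
      0 < t ∧ E0 A X ≤ E0 A (X + (t : ℂ) • curveDir X Z t) := by
  obtain ⟨hX, δ, hδ, hmin⟩ := h
  have hc : Continuous fun t : ℝ => frobNorm (X + (t : ℂ) • curveDir X Z t - X) := by
    refine continuous_frobNorm.comp ?_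
    exact (continuous_const.add (Complex.continuous_ofReal.smul (continuous_curveDir X Z))).sub
      continuous_const
  have h0 : frobNorm (X + ((0 : ℝ) : ℂ) • curveDir X Z 0 - X) < δ := by
    simpa [frobNorm] using hδ
  have := (hc.tendsto 0).eventually (gt_mem_nhds h0)
  filter_upwards [self_mem_nhdsWithin, this.filter_mono nhdsWithin_le_nhds] with t ht ht'
  exact ⟨ht, hmin _ (add_smul_curveDir_mem hX hZ t) ht'⟩

/-- The second order remainder is continuous along the curve. -/
theorem continuous_quad_curveDir {n p : ℕ} (A : Matrix (Fin n) (Fin n) ℂ)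
    (X Z : Matrix (Fin n) (Fin p) ℂ) :
    Continuous fun t : ℝ => (A * ((gramVar X (curveDir X Z t) +
      (t : ℂ) • (curveDir X Z t * (curveDir X Z t)ᴴ)) * (gramVar X (curveDir X Z t) +
      (t : ℂ) • (curveDir X Z t * (curveDir X Z t)ᴴ)))).trace.re := by
  have hR := continuous_curveDir X Z
  have hN : Continuous fun t : ℝ => gramVar X (curveDir X Z t) +
      (t : ℂ) • (curveDir X Z t * (curveDir X Z t)ᴴ) := by
    unfold gramVar
    exact ((continuous_const.matrix_mul hR.matrix_conjTranspose).add
      (hR.matrix_mul continuous_const)).add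
      (Complex.continuous_ofReal.smul (hR.matrix_mul hR.matrix_conjTranspose))
  exact Complex.continuous_re.comp (continuous_const.matrix_mul (hN.matrix_mul hN)).matrix_trace

theorem IsLocMin.first_order {n p : ℕ} {A : Matrix (Fin n) (Fin n) ℂ} (hA : A.IsHermitian)
    {X Z : Matrix (Fin n) (Fin p) ℂ} (h : IsLocMin A X) (hZ : ∀ j, ((Xᴴ * Z) j j).re = 0) :
    0 ≤ (Zᴴ * (gradOp A X * X)).trace.re := by
  have hR := continuous_curveDir X Z
  have hc : Continuous fun t : ℝ =>
      2 * ((curveDir X Z t)ᴴ * (gradOp A X * X)).trace.re +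
      t * (((curveDir X Z t)ᴴ * (gradOp A X * curveDir X Z t)).trace.re -
        (A * ((gramVar X (curveDir X Z t) +
      (t : ℂ) • (curveDir X Z t * (curveDir X Z t)ᴴ)) * (gramVar X (curveDir X Z t) +
      (t : ℂ) • (curveDir X Z t * (curveDir X Z t)ᴴ)))).trace.re) := by
    have h1 : Continuous fun t : ℝ => ((curveDir X Z t)ᴴ * (gradOp A X * X)).trace.re :=
      Complex.continuous_re.comp (hR.matrix_conjTranspose.matrix_mul continuous_const).matrix_trace
    have h2 : Continuous fun t : ℝ =>
        ((curveDir X Z t)ᴴ * (gradOp A X * curveDir X Z t)).trace.re :=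
      Complex.continuous_re.comp (hR.matrix_conjTranspose.matrix_mul
        (continuous_const.matrix_mul hR)).matrix_trace
    exact (continuous_const.mul h1).add
      (continuous_id.mul (h2.sub (continuous_quad_curveDir A X Z)))
  have hlim := (hc.tendsto 0).mono_left (nhdsWithin_le_nhds (s := Set.Ioi 0))
  have := ge_of_tendsto hlim (b := 0) (by
    filter_upwards [h.eventually_le hZ] with t ht
    obtain ⟨ht0, hle⟩ := ht
    rw [E0_add_smul hA] at hle
    by_contra hneg
    push Not at hneg
    nlinarith [mul_neg_of_pos_of_neg ht0 hneg])
  simp only [curveDir_zero] at this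
  linarith

theorem IsLocMin.second_order {n p : ℕ} {A : Matrix (Fin n) (Fin n) ℂ} (hA : A.IsHermitian)
    {X Z : Matrix (Fin n) (Fin p) ℂ} (h : IsLocMin A X) {l : Fin p → ℝ}
    (hl : gradOp A X * X = X * diagonal (fun j => (l j : ℂ)))
    (hZ : ∀ j, ((Xᴴ * Z) j j).re = 0) :
    0 ≤ (Zᴴ * (gradOp A X * Z)).trace.re - (Zᴴ * Z * diagonal (fun j => (l j : ℂ))).trace.re -
      (A * (gramVar X Z * gramVar X Z)).trace.re := by
  have hR := continuous_curveDir X Z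
  have hc : Continuous fun t : ℝ =>
      ((curveDir X Z t)ᴴ * (gradOp A X * curveDir X Z t)).trace.re -
      ((curveDir X Z t)ᴴ * curveDir X Z t * diagonal (fun j => (l j : ℂ))).trace.re -
        (A * ((gramVar X (curveDir X Z t) +
      (t : ℂ) • (curveDir X Z t * (curveDir X Z t)ᴴ)) * (gramVar X (curveDir X Z t) +
      (t : ℂ) • (curveDir X Z t * (curveDir X Z t)ᴴ)))).trace.re := by
    have h1 : Continuous fun t : ℝ =>
        ((curveDir X Z t)ᴴ * curveDir X Z t * diagonal (fun j => (l j : ℂ))).trace.re :=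
      Complex.continuous_re.comp ((hR.matrix_conjTranspose.matrix_mul hR).matrix_mul
        continuous_const).matrix_trace
    have h2 : Continuous fun t : ℝ =>
        ((curveDir X Z t)ᴴ * (gradOp A X * curveDir X Z t)).trace.re :=
      Complex.continuous_re.comp (hR.matrix_conjTranspose.matrix_mul
        (continuous_const.matrix_mul hR)).matrix_trace
    exact (h2.sub h1).sub (continuous_quad_curveDir A X Z)
  have hlim := (hc.tendsto 0).mono_left (nhdsWithin_le_nhds (s := Set.Ioi 0))
  have := ge_of_tendsto hlim (b := 0) (by
    filter_upwards [h.eventually_le hZ] with t ht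
    obtain ⟨ht0, hle⟩ := ht
    have hmem := add_smul_curveDir_mem h.1 hZ t
    rw [E0_add_smul hA, hl] at hle
    set R := curveDir X Z t
    have hjj : ∀ j, 2 * ((Rᴴ * X) j j).re = - (t * ((Rᴴ * R) j j).re) := by
      intro j
      have h1 := hmem j
      have h2 := h.1 j
      have hs : (Xᴴ * R) j j = star ((Rᴴ * X) j j) := by
        rw [← Matrix.conjTranspose_apply, conjTranspose_mul, conjTranspose_conjTranspose]
      simp only [conjTranspose_add, conjTranspose_smul, Matrix.add_mul, Matrix.mul_add,
        Matrix.smul_mul, Matrix.mul_smul, Matrix.add_apply, Matrix.smul_apply, h2, hs,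
        smul_eq_mul, RCLike.star_def, Complex.conj_ofReal] at h1
      have h3 := congrArg Complex.re h1
      simp only [Complex.add_re, Complex.re_ofReal_mul, Complex.conj_re, Complex.one_re] at h3
      have h4 : t * (2 * ((Rᴴ * X) j j).re + t * ((Rᴴ * R) j j).re) = 0 := by linarith
      have := (mul_eq_zero.1 h4).resolve_left ht0.ne'
      linarith
    have hsum : 2 * (Rᴴ * (X * diagonal (fun j => (l j : ℂ)))).trace.re =
        - (t * (Rᴴ * R * diagonal (fun j => (l j : ℂ))).trace.re) := by
      rw [← Matrix.mul_assoc]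
      simp only [Matrix.trace, Matrix.diag_apply, Matrix.mul_diagonal, Complex.re_sum,
        Complex.re_mul_ofReal, Finset.mul_sum, ← Finset.sum_neg_distrib]
      refine Finset.sum_congr rfl fun j _ => ?_
      linear_combination (l j) * hjj j
    rw [hsum] at hle
    by_contra hneg
    push Not at hneg
    nlinarith [mul_neg_of_pos_of_neg (pow_pos ht0 2) hneg])
  simpa only [curveDir_zero, Complex.ofReal_zero, zero_smul, add_zero] using this

theorem IsLocMin.exists_multipliers {n p : ℕ} {A : Matrix (Fin n) (Fin n) ℂ}
    (hA : A.IsHermitian) {X : Matrix (Fin n) (Fin p) ℂ} (h : IsLocMin A X) :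
    ∃ l : Fin p → ℝ, gradOp A X * X = X * diagonal (fun j => (l j : ℂ)) := by
  let l : Fin p → ℝ := fun j => ((Xᴴ * (gradOp A X * X)) j j).re
  refine ⟨l, ?_⟩
  set Z := X * diagonal (fun j => (l j : ℂ)) - gradOp A X * X with hZdef
  have hZ : ∀ j, ((Xᴴ * Z) j j).re = 0 := by
    intro j
    rw [hZdef, Matrix.mul_sub, ← Matrix.mul_assoc, Matrix.sub_apply, Matrix.mul_diagonal, h.1 j]
    simp [l]
  have hZ' : ∀ j, ((Zᴴ * X) j j).re = 0 := by
    intro j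
    have hs : (Zᴴ * X) j j = star ((Xᴴ * Z) j j) := by
      rw [← Matrix.conjTranspose_apply, conjTranspose_mul, conjTranspose_conjTranspose]
    rw [hs]; simpa using hZ j
  have h1 := h.first_order hA hZ
  have h2 : (Zᴴ * (X * diagonal (fun j => (l j : ℂ)))).trace.re = 0 := by
    rw [← Matrix.mul_assoc]
    simp only [Matrix.trace, Matrix.diag_apply, Matrix.mul_diagonal, Complex.re_sum,
      Complex.re_mul_ofReal, hZ', zero_mul, Finset.sum_const_zero]
  have h3 : (Zᴴ * Z).trace.re ≤ 0 := by
    have : gradOp A X * X = X * diagonal (fun j => (l j : ℂ)) - Z := by rw [hZdef]; abel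
    rw [this, Matrix.mul_sub, Matrix.trace_sub, Complex.sub_re, h2] at h1
    linarith
  have h5 := eq_zero_of_trace_conjTranspose_mul_self_nonpos h3
  rw [hZdef, sub_eq_zero] at h5
  exact h5.symm

/-- The squared norm of a column vector. -/
def nsq {m : ℕ} (w : Matrix (Fin m) (Fin 1) ℂ) : ℝ := (wᴴ * w).trace.re

/-- The real part of the sesquilinear form of `A` evaluated at a column vector. -/
def qf {m : ℕ} (A : Matrix (Fin m) (Fin m) ℂ) (w : Matrix (Fin m) (Fin 1) ℂ) : ℝ :=
  (wᴴ * (A * w)).trace.re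

theorem qf_one {m : ℕ} (w : Matrix (Fin m) (Fin 1) ℂ) : qf 1 w = nsq w := by
  simp [qf, nsq]

theorem nsq_nonneg {m : ℕ} (w : Matrix (Fin m) (Fin 1) ℂ) : 0 ≤ nsq w := by
  rw [nsq, trace_conjTranspose_mul_self_eq]
  exact Finset.sum_nonneg fun _ _ => Finset.sum_nonneg fun _ _ => Complex.normSq_nonneg _

theorem nsq_pos {m : ℕ} {w : Matrix (Fin m) (Fin 1) ℂ} (hw : w ≠ 0) : 0 < nsq w := by
  by_contra h
  exact hw (eq_zero_of_trace_conjTranspose_mul_self_nonpos (not_lt.1 h))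

theorem conjTranspose_mul_mul_eq_qf {m : ℕ} {A : Matrix (Fin m) (Fin m) ℂ} (hA : A.IsHermitian)
    (w : Matrix (Fin m) (Fin 1) ℂ) : wᴴ * (A * w) = (qf A w : ℂ) • 1 := by
  have h : (wᴴ * (A * w))ᴴ = wᴴ * (A * w) := by
    rw [conjTranspose_mul, conjTranspose_mul, conjTranspose_conjTranspose, hA.eq, Matrix.mul_assoc]
  have h0 := congrFun (congrFun h 0) 0
  rw [conjTranspose_apply, RCLike.star_def, Complex.conj_eq_iff_re] at h0
  ext i j
  rw [Subsingleton.elim i 0, Subsingleton.elim j 0, qf, Matrix.trace_fin_one, h0]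
  simp

theorem conjTranspose_mul_self_eq_nsq {m : ℕ} (w : Matrix (Fin m) (Fin 1) ℂ) :
    wᴴ * w = (nsq w : ℂ) • 1 := by
  rw [← qf_one, ← conjTranspose_mul_mul_eq_qf Matrix.isHermitian_one, Matrix.one_mul]

theorem trace_mul_conjTranspose_self {m : ℕ} (w : Matrix (Fin m) (Fin 1) ℂ) :
    (w * wᴴ).trace = nsq w := by
  rw [Matrix.trace_mul_comm, conjTranspose_mul_self_eq_nsq]; simp

theorem trace_mul_mul_conjTranspose {m : ℕ} {A : Matrix (Fin m) (Fin m) ℂ} (hA : A.IsHermitian)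
    (w : Matrix (Fin m) (Fin 1) ℂ) : (A * (w * wᴴ)).trace = qf A w := by
  rw [← Matrix.mul_assoc, Matrix.trace_mul_comm, conjTranspose_mul_mul_eq_qf hA]; simp

theorem qf_diagonal {m : ℕ} (b : Fin m → ℝ) (w : Matrix (Fin m) (Fin 1) ℂ) :
    qf (diagonal fun i => (b i : ℂ)) w = ∑ i, b i * Complex.normSq (w i 0) := by
  rw [qf, Matrix.trace_fin_one, Matrix.mul_apply, Complex.re_sum]
  refine Finset.sum_congr rfl fun i _ => ?_
  rw [Matrix.diagonal_mul, conjTranspose_apply, RCLike.star_def, mul_left_comm,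
    Complex.re_ofReal_mul, ← Complex.normSq_eq_conj_mul_self, Complex.ofReal_re]

theorem nsq_eq_sum {m : ℕ} (w : Matrix (Fin m) (Fin 1) ℂ) :
    nsq w = ∑ i, Complex.normSq (w i 0) := by
  rw [nsq, trace_conjTranspose_mul_self_eq]; simp

theorem nsq_mul {m q : ℕ} {P : Matrix (Fin m) (Fin q) ℂ} (hP : Pᴴ * P = 1)
    (a : Matrix (Fin q) (Fin 1) ℂ) : nsq (P * a) = nsq a := by
  rw [nsq, conjTranspose_mul, Matrix.mul_assoc, ← Matrix.mul_assoc Pᴴ, hP, Matrix.one_mul, nsq]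

theorem qf_mul {m q : ℕ} (A : Matrix (Fin m) (Fin m) ℂ) (P : Matrix (Fin m) (Fin q) ℂ)
    (a : Matrix (Fin q) (Fin 1) ℂ) : qf A (P * a) = qf (Pᴴ * (A * P)) a := by
  simp only [qf, conjTranspose_mul, Matrix.mul_assoc]

theorem qf_mul_of_eigen {m q : ℕ} {A : Matrix (Fin m) (Fin m) ℂ} {P : Matrix (Fin m) (Fin q) ℂ}
    {α : Fin q → ℝ} (hP : Pᴴ * P = 1) (hAP : A * P = P * diagonal fun i => (α i : ℂ))
    (a : Matrix (Fin q) (Fin 1) ℂ) : qf A (P * a) = ∑ i, α i * Complex.normSq (a i 0) := by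
  rw [qf_mul, hAP, ← Matrix.mul_assoc, hP, Matrix.one_mul, qf_diagonal]

theorem exists_mul_eq_zero {k : ℕ} (B : Matrix (Fin k) (Fin (k + 1)) ℂ) :
    ∃ a : Matrix (Fin (k + 1)) (Fin 1) ℂ, a ≠ 0 ∧ B * a = 0 := by
  have h := LinearMap.ker_ne_bot_of_finrank_lt (f := B.mulVecLin) (by simp)
  obtain ⟨v, hv, hv0⟩ := Submodule.exists_mem_ne_zero_of_ne_bot h
  refine ⟨fun i _ => v i, fun h0 => hv0 (funext fun i => congrFun (congrFun h0 i) 0), ?_⟩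
  ext i j
  exact congrFun (LinearMap.mem_ker.1 hv) i

/-- A Courant-Fischer type comparison: if `A` is at most `s` on a `k + 1`-dimensional invariant
subspace and at least `r` on a complement of codimension at most `k`, then `r ≤ s`. -/
theorem le_of_eigen_compare {n q k : ℕ} (hk : k ≤ q) {A : Matrix (Fin n) (Fin n) ℂ}
    (hA : A.IsHermitian)
    {P : Matrix (Fin n) (Fin (k + 1)) ℂ} {α : Fin (k + 1) → ℝ} (hP : Pᴴ * P = 1)
    (hAP : A * P = P * diagonal fun i => (α i : ℂ))
    {R : Matrix (Fin n) (Fin q) ℂ} {β : Fin q → ℝ} (hR : Rᴴ * R = 1)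
    (hAR : A * R = R * diagonal fun i => (β i : ℂ)) {r s : ℝ} (hs : ∀ i, α i ≤ s)
    (hr : ∀ i : Fin q, k ≤ i → r ≤ β i)
    (hw : ∀ w : Matrix (Fin n) (Fin 1) ℂ, Rᴴ * w = 0 → r * nsq w ≤ qf A w) : r ≤ s := by
  obtain ⟨a, ha, hBa⟩ := exists_mul_eq_zero ((Rᴴ * P).submatrix (Fin.castLE hk) id)
  have hupper : qf A (P * a) ≤ s * nsq (P * a) := by
    rw [qf_mul_of_eigen hP hAP, nsq_mul hP, nsq_eq_sum, Finset.mul_sum]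
    exact Finset.sum_le_sum fun i _ =>
      mul_le_mul_of_nonneg_right (hs i) (Complex.normSq_nonneg _)
  have hpos : 0 < nsq (P * a) := by rw [nsq_mul hP]; exact nsq_pos ha
  set z := P * a
  set b := Rᴴ * z with hb
  have hb0 : ∀ i : Fin q, (i : ℕ) < k → b i 0 = 0 := by
    intro i hi
    have := congrFun (congrFun hBa ⟨i, hi⟩) 0
    rw [hb, ← Matrix.mul_assoc]
    exact this
  set w := z - R * b with hwdef
  have hRw : Rᴴ * w = 0 := by
    rw [hwdef, Matrix.mul_sub, ← Matrix.mul_assoc Rᴴ R, hR, Matrix.one_mul, sub_self]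
  have hwR : wᴴ * R = 0 := by
    rw [← conjTranspose_conjTranspose R, ← conjTranspose_mul, hRw, conjTranspose_zero]
  have hz : z = R * b + w := by rw [hwdef]; abel
  have hRAw : Rᴴ * (A * w) = 0 := by
    have : (Rᴴ * (A * w))ᴴ = 0 := by
      rw [conjTranspose_mul, conjTranspose_mul, conjTranspose_conjTranspose, hA.eq,
        Matrix.mul_assoc, hAR, ← Matrix.mul_assoc, hwR, Matrix.zero_mul]
    rw [← conjTranspose_conjTranspose (Rᴴ * (A * w)), this, conjTranspose_zero]
  have hnsq : nsq z = nsq (R * b) + nsq w := by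
    have h1 : wᴴ * (R * b) = 0 := by rw [← Matrix.mul_assoc, hwR, Matrix.zero_mul]
    simp only [nsq, hz, conjTranspose_add, Matrix.add_mul, Matrix.mul_add, h1, conjTranspose_mul,
      Matrix.mul_assoc, hRw, Matrix.mul_zero, Matrix.trace_add, Complex.add_re, add_zero, zero_add]
  have hqf : qf A z = qf A (R * b) + qf A w := by
    have h1 : wᴴ * (A * (R * b)) = 0 := by
      rw [← Matrix.mul_assoc A, hAR, Matrix.mul_assoc, ← Matrix.mul_assoc wᴴ, hwR, Matrix.zero_mul]
    simp only [qf, hz, conjTranspose_add, Matrix.add_mul, Matrix.mul_add, h1, conjTranspose_mul,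
      Matrix.mul_assoc, hRAw, Matrix.mul_zero, Matrix.trace_add, Complex.add_re, add_zero,
      zero_add]
  have hlower : r * nsq (R * b) ≤ qf A (R * b) := by
    rw [qf_mul_of_eigen hR hAR, nsq_mul hR, nsq_eq_sum, Finset.mul_sum]
    refine Finset.sum_le_sum fun i _ => ?_
    rcases lt_or_ge (i : ℕ) k with hi | hi
    · rw [hb0 i hi]; simp
    · exact mul_le_mul_of_nonneg_right (hr i hi) (Complex.normSq_nonneg _)
  have := hw w hRw
  refine le_of_mul_le_mul_right ?_ hpos
  linarith [congrArg (r * ·) hnsq, mul_add r (nsq (R * b)) (nsq w)]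

theorem sortedEig_monotone {n : ℕ} {A : Matrix (Fin n) (Fin n) ℂ} (hA : A.IsHermitian) :
    Monotone (sortedEig hA) :=
  Tuple.monotone_sort hA.eigenvalues

theorem exists_sorted_eigenbasis {n : ℕ} {A : Matrix (Fin n) (Fin n) ℂ} (hA : A.IsHermitian) :
    ∃ U : Matrix (Fin n) (Fin n) ℂ, Uᴴ * U = 1 ∧ U * Uᴴ = 1 ∧
      A * U = U * diagonal fun i => (sortedEig hA i : ℂ) := by
  set E : Matrix (Fin n) (Fin n) ℂ := hA.eigenvectorUnitary.1
  have hE : Eᴴ * E = 1 := Matrix.mem_unitaryGroup_iff'.1 hA.eigenvectorUnitary.2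
  set σ := Tuple.sort hA.eigenvalues
  have h1 : (E.submatrix id σ)ᴴ * E.submatrix id σ = 1 := by
    rw [← Matrix.submatrix_one_equiv σ, ← hE]
    rfl
  refine ⟨E.submatrix id σ, h1, mul_eq_one_comm.1 h1, ?_⟩
  ext i j
  have := congrFun (hA.eigenvectorUnitary_mulVec (σ j)) i
  have h2 := congrFun (hA.mulVec_eigenvectorBasis (σ j)) i
  rw [Matrix.mul_diagonal]
  refine Eq.trans ?_ (h2.trans ?_)
  · rfl
  · rw [mul_comm]
    rfl

theorem qf_of_eigen {m : ℕ} {C : Matrix (Fin m) (Fin m) ℂ} {c : Matrix (Fin m) (Fin 1) ℂ} {μ : ℝ}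
    (h : C * c = (μ : ℂ) • c) : qf C c = μ * nsq c := by
  rw [qf, h, Matrix.mul_smul, Matrix.trace_smul, smul_eq_mul, Complex.re_ofReal_mul, nsq]

/-- The `j`-th column of `V`, as a one-column matrix. -/
def colMat {m q : ℕ} (V : Matrix (Fin m) (Fin q) ℂ) (j : Fin q) : Matrix (Fin m) (Fin 1) ℂ :=
  V.submatrix id fun _ => j

theorem mul_colMat_of_eigen {m q : ℕ} {C : Matrix (Fin m) (Fin m) ℂ} {V : Matrix (Fin m) (Fin q) ℂ}
    {μ : Fin q → ℝ} (h : C * V = V * diagonal fun i => (μ i : ℂ)) (j : Fin q) :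
    C * colMat V j = (μ j : ℂ) • colMat V j := by
  ext i k
  have := congrFun (congrFun h i) j
  rw [Matrix.mul_diagonal, mul_comm] at this
  exact this

theorem nsq_colMat {m q : ℕ} {V : Matrix (Fin m) (Fin q) ℂ} (h : Vᴴ * V = 1) (j : Fin q) :
    nsq (colMat V j) = 1 := by
  have : (Vᴴ * V) j j = 1 := by rw [h]; simp
  rw [nsq, Matrix.trace_fin_one]
  exact congrArg Complex.re this

theorem submatrix_isometry {m q k : ℕ} {P : Matrix (Fin m) (Fin q) ℂ} (hP : Pᴴ * P = 1)
    {e : Fin k → Fin q} (he : Function.Injective e) :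
    (P.submatrix id e)ᴴ * P.submatrix id e = 1 := by
  rw [← Matrix.submatrix_one e he, ← hP]
  rfl

theorem submatrix_eigen {m q k : ℕ} {A : Matrix (Fin m) (Fin m) ℂ} {P : Matrix (Fin m) (Fin q) ℂ}
    {α : Fin q → ℝ} (h : A * P = P * diagonal fun i => (α i : ℂ)) (e : Fin k → Fin q) :
    A * P.submatrix id e = P.submatrix id e * diagonal fun i => (α (e i) : ℂ) := by
  ext i j
  have := congrFun (congrFun h i) (e j)
  rw [Matrix.mul_diagonal] at this ⊢
  exact this

open scoped ComplexOrder in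
theorem exists_conjTranspose_mul_eq_zero {n p : ℕ} (hpn : p ≤ n) {X : Matrix (Fin n) (Fin p) ℂ}
    {c : Matrix (Fin p) (Fin 1) ℂ} (hc : c ≠ 0) (hXc : X * c = 0) :
    ∃ w : Matrix (Fin n) (Fin 1) ℂ, w ≠ 0 ∧ Xᴴ * w = 0 := by
  have hker : 0 < Module.finrank ℂ (LinearMap.ker X.mulVecLin) := by
    rw [Nat.pos_iff_ne_zero, Ne, Submodule.finrank_eq_zero]
    intro h
    refine hc (Matrix.ext fun i j => ?_)
    have hmem : (fun i => c i j) ∈ LinearMap.ker X.mulVecLin := by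
      rw [LinearMap.mem_ker]
      exact funext fun i => congrFun (congrFun hXc i) j
    rw [h, Submodule.mem_bot] at hmem
    exact congrFun hmem i
  have h1 := LinearMap.finrank_range_add_finrank_ker X.mulVecLin
  have h2 := LinearMap.finrank_range_add_finrank_ker Xᴴ.mulVecLin
  have h3 : Module.finrank ℂ (LinearMap.range Xᴴ.mulVecLin) =
      Module.finrank ℂ (LinearMap.range X.mulVecLin) := Matrix.rank_conjTranspose X
  simp only [Module.finrank_fin_fun] at h1 h2
  have h4 : LinearMap.ker Xᴴ.mulVecLin ≠ ⊥ := by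
    intro h
    rw [h, finrank_bot] at h2
    omega
  obtain ⟨v, hv, hv0⟩ := Submodule.exists_mem_ne_zero_of_ne_bot h4
  refine ⟨fun i _ => v i, fun h0 => hv0 (funext fun i => congrFun (congrFun h0 i) 0), ?_⟩
  ext i j
  exact congrFun (LinearMap.mem_ker.1 hv) i

/-- The second order condition in the direction `w * cᴴ`, with `w` orthogonal to the columns
of `X`, at a critical point whose multipliers all agree. -/
theorem IsLocMin.second_order_rank_one {n p : ℕ} {A : Matrix (Fin n) (Fin n) ℂ}
    (hA : A.IsHermitian) {X : Matrix (Fin n) (Fin p) ℂ} (h : IsLocMin A X) {lam : ℝ}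
    (hl : gradOp A X * X = (lam : ℂ) • X) {w : Matrix (Fin n) (Fin 1) ℂ} (hw : Xᴴ * w = 0)
    (c : Matrix (Fin p) (Fin 1) ℂ) :
    0 ≤ nsq c * (2 * qf A w - lam * nsq w) -
      (nsq w * qf A (X * c) + nsq (X * c) * qf A w) := by
  have hd : diagonal (fun _ : Fin p => (lam : ℂ)) = (lam : ℂ) • 1 := by
    rw [← Matrix.smul_one_eq_diagonal]
  have hwX : wᴴ * X = 0 := by
    rw [← conjTranspose_conjTranspose X, ← conjTranspose_mul, hw, conjTranspose_zero]
  have hso := h.second_order hA (l := fun _ => lam) (Z := w * cᴴ)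
    (by rw [hl, hd, Matrix.mul_smul, Matrix.mul_one])
    (fun j => by rw [← Matrix.mul_assoc, hw, Matrix.zero_mul]; rfl)
  have e1 : ((w * cᴴ)ᴴ * (gradOp A X * (w * cᴴ))).trace.re = nsq c * (2 * qf A w) := by
    have hin : wᴴ * (gradOp A X * w) = ((2 * qf A w : ℝ) : ℂ) • 1 := by
      have : gradOp A X * w = (2 : ℂ) • (A * w) - X * (Xᴴ * (A * w)) := by
        simp only [gradOp, Matrix.sub_mul, Matrix.smul_mul, Matrix.mul_assoc, hw, Matrix.mul_zero,
          sub_zero]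
      rw [this, Matrix.mul_sub, Matrix.mul_smul, ← Matrix.mul_assoc wᴴ X, hwX, Matrix.zero_mul,
        sub_zero, conjTranspose_mul_mul_eq_qf hA, smul_smul]
      simp
    rw [conjTranspose_mul, conjTranspose_conjTranspose,
      show c * wᴴ * (gradOp A X * (w * cᴴ)) = c * (wᴴ * (gradOp A X * w)) * cᴴ by
        simp only [Matrix.mul_assoc], hin, Matrix.mul_smul, Matrix.mul_one, Matrix.smul_mul,
      Matrix.trace_smul, trace_mul_conjTranspose_self, smul_eq_mul, ← Complex.ofReal_mul,
      Complex.ofReal_re, mul_comm]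
  have e2 : ((w * cᴴ)ᴴ * (w * cᴴ) * diagonal (fun _ : Fin p => (lam : ℂ))).trace.re =
      nsq c * (lam * nsq w) := by
    rw [hd, Matrix.mul_smul, Matrix.mul_one, conjTranspose_mul, conjTranspose_conjTranspose,
      show c * wᴴ * (w * cᴴ) = c * (wᴴ * w) * cᴴ by simp only [Matrix.mul_assoc],
      conjTranspose_mul_self_eq_nsq, Matrix.mul_smul, Matrix.mul_one, Matrix.smul_mul, smul_smul,
      Matrix.trace_smul, trace_mul_conjTranspose_self, smul_eq_mul, ← Complex.ofReal_mul,
      ← Complex.ofReal_mul, Complex.ofReal_re]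
    ring
  have e3 : (A * (gramVar X (w * cᴴ) * gramVar X (w * cᴴ))).trace.re =
      nsq w * qf A (X * c) + nsq (X * c) * qf A w := by
    have hN : gramVar X (w * cᴴ) = (X * c) * wᴴ + w * (X * c)ᴴ := by
      simp only [gramVar, conjTranspose_mul, conjTranspose_conjTranspose, Matrix.mul_assoc]
    have h1 : wᴴ * (X * c) = 0 := by rw [← Matrix.mul_assoc, hwX, Matrix.zero_mul]
    have h2 : (X * c)ᴴ * w = 0 := by rw [conjTranspose_mul, Matrix.mul_assoc, hw, Matrix.mul_zero]
    rw [hN]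
    set y := X * c
    have hNN : (y * wᴴ + w * yᴴ) * (y * wᴴ + w * yᴴ) =
        (nsq w : ℂ) • (y * yᴴ) + (nsq y : ℂ) • (w * wᴴ) := by
      have : (y * wᴴ + w * yᴴ) * (y * wᴴ + w * yᴴ) =
          y * (wᴴ * y) * wᴴ + y * (wᴴ * w) * yᴴ + w * (yᴴ * y) * wᴴ + w * (yᴴ * w) * yᴴ := by
        simp only [Matrix.add_mul, Matrix.mul_add, Matrix.mul_assoc]; abel
      rw [this, h1, h2, conjTranspose_mul_self_eq_nsq, conjTranspose_mul_self_eq_nsq]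
      simp
    rw [hNN, Matrix.mul_add, Matrix.mul_smul, Matrix.mul_smul, Matrix.trace_add, Matrix.trace_smul,
      Matrix.trace_smul, trace_mul_mul_conjTranspose hA, trace_mul_mul_conjTranspose hA,
      smul_eq_mul, smul_eq_mul, ← Complex.ofReal_mul, ← Complex.ofReal_mul, ← Complex.ofReal_add,
      Complex.ofReal_re]
  rw [e1, e2, e3] at hso
  linarith

theorem conjTranspose_diagonal_ofReal {p : ℕ} (l : Fin p → ℝ) :
    (diagonal fun j => (l j : ℂ))ᴴ = diagonal fun j => (l j : ℂ) := by
  rw [diagonal_conjTranspose]; congr 1; ext j; simp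

theorem multipliers_commute {n p : ℕ} {A : Matrix (Fin n) (Fin n) ℂ} (hA : A.IsHermitian)
    {X : Matrix (Fin n) (Fin p) ℂ} {l : Fin p → ℝ}
    (hl : gradOp A X * X = X * diagonal (fun j => (l j : ℂ))) :
    diagonal (fun j => (l j : ℂ)) * (Xᴴ * X) = Xᴴ * X * diagonal (fun j => (l j : ℂ)) := by
  have h1 : Xᴴ * (gradOp A X * X) = Xᴴ * X * diagonal (fun j => (l j : ℂ)) := by
    rw [hl, Matrix.mul_assoc]
  have h2 : (Xᴴ * (gradOp A X * X))ᴴ = Xᴴ * (gradOp A X * X) := by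
    rw [conjTranspose_mul, conjTranspose_mul, conjTranspose_conjTranspose, gradOp_isHermitian hA,
      Matrix.mul_assoc]
  rw [← h1, ← h2, h1, conjTranspose_mul, conjTranspose_mul, conjTranspose_conjTranspose,
    conjTranspose_diagonal_ofReal]

theorem diag_mul_conjTranspose_eq_zero {p : ℕ} {l : Fin p → ℝ} {a b : ℝ} (hab : a ≠ b)
    {u v : Matrix (Fin p) (Fin 1) ℂ}
    (hu : diagonal (fun j => (l j : ℂ)) * u = (a : ℂ) • u)
    (hv : diagonal (fun j => (l j : ℂ)) * v = (b : ℂ) • v) (i : Fin p) :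
    u i 0 * star (v i 0) = 0 := by
  have h1 := congrFun (congrFun hu i) 0
  have h2 := congrFun (congrFun hv i) 0
  rw [Matrix.diagonal_mul, Matrix.smul_apply, smul_eq_mul] at h1 h2
  by_contra hne
  obtain ⟨hu0, hv0⟩ := mul_ne_zero_iff.1 hne
  have h3 := Complex.ofReal_injective (mul_right_cancel₀ hu0 h1)
  have h4 := Complex.ofReal_injective (mul_right_cancel₀ (star_ne_zero.1 hv0) h2)
  exact hab (h3.symm.trans h4)

/-- The second order condition along `X * S`, with `S = u * vᴴ - v * uᴴ` mixing two different
multiplier eigenspaces. -/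
theorem IsLocMin.second_order_skew {n p : ℕ} {A : Matrix (Fin n) (Fin n) ℂ}
    (hA : A.IsHermitian) {X : Matrix (Fin n) (Fin p) ℂ} (h : IsLocMin A X) {l : Fin p → ℝ}
    (hl : gradOp A X * X = X * diagonal (fun j => (l j : ℂ))) {a b : ℝ} (hab : a ≠ b)
    {u v : Matrix (Fin p) (Fin 1) ℂ}
    (hu : diagonal (fun j => (l j : ℂ)) * u = (a : ℂ) • u)
    (hv : diagonal (fun j => (l j : ℂ)) * v = (b : ℂ) • v) :
    0 ≤ (a - b) * (qf (Xᴴ * X) u * nsq v - qf (Xᴴ * X) v * nsq u) := by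
  have hcomm := multipliers_commute hA hl
  have hG : (Xᴴ * X).IsHermitian := Matrix.isHermitian_conjTranspose_mul_self X
  set L : Matrix (Fin p) (Fin p) ℂ := diagonal (fun j => (l j : ℂ)) with hL
  have hLH : Lᴴ = L := conjTranspose_diagonal_ofReal l
  have hGu : L * (Xᴴ * X * u) = (a : ℂ) • (Xᴴ * X * u) := by
    rw [← Matrix.mul_assoc, hcomm, Matrix.mul_assoc, hu, Matrix.mul_smul]
  have hGv : L * (Xᴴ * X * v) = (b : ℂ) • (Xᴴ * X * v) := by
    rw [← Matrix.mul_assoc, hcomm, Matrix.mul_assoc, hv, Matrix.mul_smul]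
  have horth : uᴴ * (Xᴴ * X * v) = 0 := by
    ext i j
    rw [Matrix.mul_apply]
    refine Finset.sum_eq_zero fun k _ => ?_
    rw [conjTranspose_apply, mul_comm, Subsingleton.elim i 0, Subsingleton.elim j 0]
    exact diag_mul_conjTranspose_eq_zero hab.symm hGv hu k
  have horth' : vᴴ * (Xᴴ * X * u) = 0 := by
    have : (uᴴ * (Xᴴ * X * v))ᴴ = vᴴ * (Xᴴ * X * u) := by
      rw [conjTranspose_mul, conjTranspose_mul, conjTranspose_conjTranspose, hG.eq,
        Matrix.mul_assoc]
    rw [← this, horth, conjTranspose_zero]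
  set S := u * vᴴ - v * uᴴ with hS
  have hSH : Sᴴ = -S := by
    rw [hS]; simp
  have hZ : ∀ j, ((Xᴴ * (X * S)) j j).re = 0 := by
    intro j
    have h1 := diag_mul_conjTranspose_eq_zero hab hGu hv j
    have h2 := diag_mul_conjTranspose_eq_zero hab.symm hGv hu j
    have : (Xᴴ * (X * S)) j j = (Xᴴ * X * u) j 0 * star (v j 0) -
        (Xᴴ * X * v) j 0 * star (u j 0) := by
      rw [← Matrix.mul_assoc, hS, Matrix.mul_sub, ← Matrix.mul_assoc _ u, ← Matrix.mul_assoc _ v,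
        Matrix.sub_apply, Matrix.mul_apply (N := vᴴ), Matrix.mul_apply (N := uᴴ)]
      simp
    rw [this, h1, h2]; simp
  have hso := h.second_order hA hl hZ
  have hN : gramVar X (X * S) = 0 := by
    rw [gramVar, conjTranspose_mul, hSH, Matrix.neg_mul, Matrix.mul_neg, Matrix.mul_assoc]
    exact neg_add_cancel _
  have hvL : vᴴ * L = (b : ℂ) • vᴴ := by
    have := congrArg conjTranspose hv
    rw [conjTranspose_mul, hLH, conjTranspose_smul] at this
    simpa using this
  have huL : uᴴ * L = (a : ℂ) • uᴴ := by
    have := congrArg conjTranspose hu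
    rw [conjTranspose_mul, hLH, conjTranspose_smul] at this
    simpa using this
  have hLS : L * S - S * L = ((a - b : ℝ) : ℂ) • (u * vᴴ + v * uᴴ) := by
    rw [hS, Matrix.mul_sub, Matrix.sub_mul, ← Matrix.mul_assoc, ← Matrix.mul_assoc, hu, hv,
      Matrix.mul_assoc u, Matrix.mul_assoc v, hvL, huL]
    simp only [Matrix.smul_mul, Matrix.mul_smul]
    push_cast
    module
  have hq : ((X * S)ᴴ * (gradOp A X * (X * S))).trace.re - ((X * S)ᴴ * (X * S) * L).trace.re =
      (Sᴴ * (Xᴴ * X * (L * S - S * L))).trace.re := by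
    rw [← Matrix.mul_assoc (gradOp A X), hl, ← Complex.sub_re, ← Matrix.trace_sub]
    simp only [conjTranspose_mul, Matrix.mul_assoc, Matrix.mul_sub]
  have hfin : Sᴴ * (Xᴴ * X * (u * vᴴ + v * uᴴ)) =
      (qf (Xᴴ * X) u : ℂ) • (v * vᴴ) - (qf (Xᴴ * X) v : ℂ) • (u * uᴴ) := by
    have : Sᴴ * (Xᴴ * X * (u * vᴴ + v * uᴴ)) = v * (uᴴ * (Xᴴ * X * u)) * vᴴ +
        v * (uᴴ * (Xᴴ * X * v)) * uᴴ - u * (vᴴ * (Xᴴ * X * u)) * vᴴ -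
        u * (vᴴ * (Xᴴ * X * v)) * uᴴ := by
      rw [hSH, hS]
      simp only [Matrix.mul_add, Matrix.sub_mul, Matrix.neg_mul, Matrix.mul_assoc]
      abel
    rw [this, horth, horth', conjTranspose_mul_mul_eq_qf hG, conjTranspose_mul_mul_eq_qf hG]
    simp
  rw [hN, hq, hLS, Matrix.mul_smul, Matrix.mul_smul, hfin, Matrix.trace_smul, Matrix.trace_sub,
    Matrix.trace_smul, Matrix.trace_smul, trace_mul_conjTranspose_self,
    trace_mul_conjTranspose_self] at hso
  simpa [← Complex.ofReal_mul, ← Complex.ofReal_sub] using hso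

theorem IsLocMin.multipliers_const_or_orthonormal {n p : ℕ} {A : Matrix (Fin n) (Fin n) ℂ}
    (hA : A.IsHermitian) {X : Matrix (Fin n) (Fin p) ℂ} (h : IsLocMin A X) {l : Fin p → ℝ}
    (hl : gradOp A X * X = X * diagonal (fun j => (l j : ℂ))) :
    (∀ j k, l j = l k) ∨ Xᴴ * X = 1 := by
  by_cases hall : ∀ j k, l j = l k
  · exact Or.inl hall
  right
  push Not at hall
  obtain ⟨j₀, k₀, hjk⟩ := hall
  have hcomm := multipliers_commute hA hl
  ext i j
  rcases eq_or_ne i j with rfl | hij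
  · rw [h.1 i, Matrix.one_apply_eq]
  rw [Matrix.one_apply_ne hij]
  by_cases hlij : l i = l j
  · obtain ⟨k, hk⟩ : ∃ k, l i ≠ l k := by
      by_contra hcon
      push Not at hcon
      exact hjk ((hcon j₀).symm.trans (hcon k₀))
    let e : Fin p → Matrix (Fin p) (Fin 1) ℂ := fun i => Matrix.single i 0 1
    have he : ∀ i, diagonal (fun j => (l j : ℂ)) * e i = (l i : ℂ) • e i := by
      intro i
      ext r s
      rw [Matrix.diagonal_mul, Matrix.smul_apply, smul_eq_mul]
      rcases eq_or_ne i r with rfl | hr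
      · rfl
      · simp [e, Matrix.single, hr]
    have hE : ∀ (G : Matrix (Fin p) (Fin p) ℂ) r s, ((e r)ᴴ * (G * e s)).trace = G r s := by
      intro G r s
      rw [Matrix.trace_fin_one, Matrix.mul_apply, Finset.sum_eq_single r]
      · rw [Matrix.mul_apply, Finset.sum_eq_single s]
        · simp [e]
        · intro b _ hb; simp [e, Matrix.single, hb.symm]
        · simp
      · intro b _ hb; simp [e, Matrix.single, hb.symm]
      · simp
    set g := (Xᴴ * X) i j with hg
    have hgs : (Xᴴ * X) j i = star g := by
      rw [hg, ← Matrix.conjTranspose_apply, (Matrix.isHermitian_conjTranspose_mul_self X).eq]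
    have hqk : qf (Xᴴ * X) (e k) = 1 := by rw [qf, hE, h.1 k]; rfl
    have hqu : ∀ (G : Matrix (Fin p) (Fin p) ℂ) (ω : ℂ), qf G (e i + ω • e j) =
        (G i i + star ω * ω * G j j + ω * G i j + star ω * G j i).re := by
      intro G ω
      rw [qf]
      congr 1
      simp only [conjTranspose_add, conjTranspose_smul, Matrix.add_mul, Matrix.mul_add,
        Matrix.smul_mul, Matrix.mul_smul, Matrix.trace_add, Matrix.trace_smul, hE, smul_eq_mul]
      ring
    have key : ∀ ω : ℂ, 0 ≤ (l i - l k) * (2 * (ω * g).re) := by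
      intro ω
      have := h.second_order_skew hA hl hk (u := e i + ω • e j) (v := e k)
        (by rw [Matrix.mul_add, Matrix.mul_smul, he, he, ← hlij, smul_add, smul_comm]) (he k)
      have hnk : nsq (e k) = 1 := by rw [← qf_one, qf, hE]; simp
      rw [hqk, hnk, ← qf_one, hqu, hqu, h.1 i, h.1 j, ← hg, hgs, Matrix.one_apply_eq,
        Matrix.one_apply_eq, Matrix.one_apply_ne hij, Matrix.one_apply_ne hij.symm] at this
      convert this using 2
      simp only [Complex.add_re, Complex.mul_re, RCLike.star_def, Complex.conj_re, Complex.conj_im,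
        Complex.zero_re, Complex.zero_im]
      ring
    have h1 := key (star g)
    have h2 := key (-star g)
    have hgg : (star g * g).re = Complex.normSq g := by
      rw [RCLike.star_def, ← Complex.normSq_eq_conj_mul_self, Complex.ofReal_re]
    rw [neg_mul, Complex.neg_re] at h2
    rw [hgg] at h1 h2
    have h3 : (l i - l k) * Complex.normSq g = 0 := by linarith
    exact Complex.normSq_eq_zero.1 ((mul_eq_zero.1 h3).resolve_left (sub_ne_zero.2 hk))
  · have := congrFun (congrFun hcomm i) j
    rw [Matrix.diagonal_mul, Matrix.mul_diagonal] at this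
    have h2 : ((l i : ℂ) - l j) * (Xᴴ * X) i j = 0 := by linear_combination this
    refine (mul_eq_zero.1 h2).resolve_left ?_
    exact sub_ne_zero.2 fun h => hlij (Complex.ofReal_injective h)

/-- If all multipliers agree at a local minimizer then its columns are orthonormal. -/
theorem IsLocMin.orthonormal_of_const {n p : ℕ} (hp : 0 < p) (hpn : p ≤ n)
    {A : Matrix (Fin n) (Fin n) ℂ} (hA : A.IsHermitian)
    (hneg : ∀ w : Matrix (Fin n) (Fin 1) ℂ, w ≠ 0 → qf A w < 0)
    {X : Matrix (Fin n) (Fin p) ℂ} (h : IsLocMin A X) {lam : ℝ}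
    (hl : gradOp A X * X = (lam : ℂ) • X) : Xᴴ * X = 1 := by
  have hG : (Xᴴ * X).IsHermitian := Matrix.isHermitian_conjTranspose_mul_self X
  obtain ⟨U, hU, hU', hGU⟩ := exists_sorted_eigenbasis hG
  set g := sortedEig hG
  have hsum : ∑ i, g i = ∑ _i : Fin p, (1 : ℝ) := by
    have h1 : (Xᴴ * X).trace = ∑ i, (g i : ℂ) := by
      have : Xᴴ * X = U * diagonal (fun i => (g i : ℂ)) * Uᴴ := by
        rw [← hGU, Matrix.mul_assoc, hU', Matrix.mul_one]
      rw [this, Matrix.trace_mul_comm, ← Matrix.mul_assoc, hU, Matrix.one_mul,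
        Matrix.trace_diagonal]
    have h2 : (Xᴴ * X).trace = ∑ _i : Fin p, (1 : ℂ) := Finset.sum_congr rfl fun i _ => h.1 i
    rw [h1] at h2
    exact_mod_cast h2
  have hc := fun i => mul_colMat_of_eigen hGU i
  have hc1 := fun i => nsq_colMat hU i
  have hy : ∀ i, nsq (X * colMat U i) = g i := by
    intro i
    rw [← qf_one, qf_mul, Matrix.one_mul, qf_of_eigen (hc i), hc1, mul_one]
  have hg0 : ∀ i, 0 ≤ g i := fun i => hy i ▸ nsq_nonneg _
  have hrel : ∀ i, 2 * (1 - g i) * qf A (X * colMat U i) = lam * g i := by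
    intro i
    have hMy : X * Xᴴ * (X * colMat U i) = (g i : ℂ) • (X * colMat U i) := by
      rw [Matrix.mul_assoc, ← Matrix.mul_assoc Xᴴ, hc, Matrix.mul_smul]
    have hHy : gradOp A X * (X * colMat U i) = (lam : ℂ) • (X * colMat U i) := by
      rw [← Matrix.mul_assoc, hl, Matrix.smul_mul]
    have h1 := qf_of_eigen hHy
    rw [hy] at h1
    rw [← h1]
    set y := X * colMat U i
    have hyM : yᴴ * (X * Xᴴ) = (g i : ℂ) • yᴴ := by
      have := congrArg conjTranspose hMy
      rw [conjTranspose_mul, (Matrix.isHermitian_mul_conjTranspose_self X).eq,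
        conjTranspose_smul] at this
      simpa using this
    have : yᴴ * (gradOp A X * y) = ((2 * (1 - g i) : ℝ) : ℂ) • (yᴴ * (A * y)) := by
      have e1 : yᴴ * (X * Xᴴ * A * y) = (g i : ℂ) • (yᴴ * (A * y)) := by
        rw [Matrix.mul_assoc _ A, ← Matrix.mul_assoc, hyM, Matrix.smul_mul]
      have e2 : yᴴ * (A * (X * Xᴴ) * y) = (g i : ℂ) • (yᴴ * (A * y)) := by
        rw [Matrix.mul_assoc A, hMy, Matrix.mul_smul, Matrix.mul_smul]
      rw [gradOp, Matrix.sub_mul, Matrix.sub_mul, Matrix.mul_sub, Matrix.mul_sub, e1, e2,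
        Matrix.smul_mul, Matrix.mul_smul]
      push_cast
      module
    rw [qf, qf, this, Matrix.trace_smul, smul_eq_mul, Complex.re_ofReal_mul]
  have hqy : ∀ i, 0 < g i → qf A (X * colMat U i) < 0 := by
    intro i hi
    refine hneg _ fun h0 => ?_
    have := hy i
    rw [h0] at this
    simp [nsq] at this
    linarith
  have hge : ∀ i, 1 ≤ g i := by
    rcases lt_or_ge lam 0 with hlam | hlam
    · exfalso
      have hlt : ∀ i, g i < 1 := by
        intro i
        rcases (hg0 i).eq_or_lt with h0 | h0
        · linarith
        · by_contra hcon
          push Not at hcon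
          nlinarith [hrel i, hqy i h0, mul_neg_of_neg_of_pos hlam h0]
      have : Nonempty (Fin p) := ⟨⟨0, hp⟩⟩
      exact absurd hsum
        (Finset.sum_lt_sum_of_nonempty Finset.univ_nonempty fun i _ => hlt i).ne
    · intro i
      rcases (hg0 i).eq_or_lt with h0 | h0
      · exfalso
        have hXc : X * colMat U i = 0 :=
          eq_zero_of_trace_conjTranspose_mul_self_nonpos (by
            have := hy i
            rw [nsq] at this
            linarith)
        have hc0 : colMat U i ≠ 0 := by
          intro hzero
          have := hc1 i
          rw [hzero] at this
          simp [nsq] at this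
        obtain ⟨w, hw, hXw⟩ := exists_conjTranspose_mul_eq_zero hpn hc0 hXc
        have := h.second_order_rank_one hA hl hXw (colMat U i)
        have hz1 : qf A (0 : Matrix (Fin n) (Fin 1) ℂ) = 0 := by simp [qf]
        have hz2 : nsq (0 : Matrix (Fin n) (Fin 1) ℂ) = 0 := by simp [nsq]
        rw [hXc, hc1, hz1, hz2] at this
        nlinarith [hneg w hw, mul_nonneg hlam (nsq_nonneg w)]
      · by_contra hcon
        push Not at hcon
        nlinarith [hrel i, mul_neg_of_pos_of_neg (sub_pos.2 hcon) (hqy i h0),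
          mul_nonneg hlam h0.le]
  have hg1 : ∀ i, g i = 1 := fun i =>
    (((Finset.sum_eq_sum_iff_of_le fun i _ => hge i).1 hsum.symm) i (Finset.mem_univ i)).symm
  have hGU' : Xᴴ * X * U = U := by
    rw [hGU]
    simp [hg1]
  rw [← Matrix.mul_one (Xᴴ * X), ← hU', ← Matrix.mul_assoc, hGU']

theorem IsLocMin.orthonormal {n p : ℕ} (hp : 0 < p) (hpn : p ≤ n)
    {A : Matrix (Fin n) (Fin n) ℂ} (hA : A.IsHermitian)
    (hneg : ∀ w : Matrix (Fin n) (Fin 1) ℂ, w ≠ 0 → qf A w < 0)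
    {X : Matrix (Fin n) (Fin p) ℂ} (h : IsLocMin A X) : Xᴴ * X = 1 := by
  obtain ⟨l, hl⟩ := h.exists_multipliers hA
  rcases h.multipliers_const_or_orthonormal hA hl with hconst | h1
  · refine h.orthonormal_of_const hp hpn hA hneg (lam := l ⟨0, hp⟩) ?_
    have : (fun j => (l j : ℂ)) = fun _ => (l ⟨0, hp⟩ : ℂ) :=
      funext fun j => by rw [hconst j ⟨0, hp⟩]
    rw [hl, this, ← Matrix.smul_one_eq_diagonal, Matrix.mul_smul, Matrix.mul_one]
  · exact h1

/-- At an orthonormal critical point all multipliers vanish. -/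
theorem gradOp_mul_eq_zero {n p : ℕ} {A : Matrix (Fin n) (Fin n) ℂ}
    {X : Matrix (Fin n) (Fin p) ℂ} {D : Matrix (Fin p) (Fin p) ℂ} (hX : Xᴴ * X = 1)
    (hl : gradOp A X * X = X * D) :
    gradOp A X * X = 0 ∧ A * X = X * (Xᴴ * (A * X)) := by
  have hH : gradOp A X * X = A * X - X * (Xᴴ * (A * X)) := by
    simp only [gradOp, Matrix.sub_mul, Matrix.smul_mul, Matrix.mul_assoc, hX, Matrix.mul_one]
    module
  have hD : D = 0 := by
    have h1 : Xᴴ * (gradOp A X * X) = D := by rw [hl, ← Matrix.mul_assoc, hX, Matrix.one_mul]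
    rw [← h1, hH, Matrix.mul_sub, ← Matrix.mul_assoc Xᴴ X, hX, Matrix.one_mul, sub_self]
  have h0 : gradOp A X * X = 0 := by rw [hl, hD, Matrix.mul_zero]
  exact ⟨h0, sub_eq_zero.1 (hH.symm.trans h0)⟩

/-- local minimizers of qOMM over the oblique manifold are of the form
`Q_p V^*` with `Q_p` orthonormal eigenvectors for the `p` smallest eigenvalues of `A`
and `V` unitary. -/
theorem qOMM_local_minimizers {n p : ℕ} (hp : 0 < p) (hpn : p ≤ n)
    (A : Matrix (Fin n) (Fin n) ℂ) (hA : A.IsHermitian)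
    (hneg : ∀ z : Fin n → ℂ, z ≠ 0 → (star z ⬝ᵥ A.mulVec z).re < 0)
    (X : Matrix (Fin n) (Fin p) ℂ) (hX : X ∈ OBset n p)
    (hmin : ∃ δ > (0 : ℝ), ∀ Y ∈ OBset n p, frobNorm (Y - X) < δ → E0 A X ≤ E0 A Y) :
    ∃ (Q : Matrix (Fin n) (Fin p) ℂ) (V : Matrix (Fin p) (Fin p) ℂ),
      Qᴴ * Q = 1 ∧
      A * Q = Q * Matrix.diagonal (fun j : Fin p => (sortedEig hA (Fin.castLE hpn j) : ℂ)) ∧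
      Vᴴ * V = 1 ∧ V * Vᴴ = 1 ∧ X = Q * Vᴴ := by
  have hmin' : IsLocMin A X := ⟨hX, hmin⟩
  have hneg' : ∀ w : Matrix (Fin n) (Fin 1) ℂ, w ≠ 0 → qf A w < 0 := by
    intro w hw
    rw [qf, Matrix.trace_fin_one]
    refine hneg (fun i => w i 0) fun h0 => hw ?_
    ext i j
    rw [Subsingleton.elim j 0]
    exact congrFun h0 i
  have hXX := hmin'.orthonormal hp hpn hA hneg'
  obtain ⟨l, hl⟩ := hmin'.exists_multipliers hA
  obtain ⟨hH, hAX⟩ := gradOp_mul_eq_zero hXX hl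
  have hC : (Xᴴ * (A * X)).IsHermitian := by
    rw [Matrix.IsHermitian, conjTranspose_mul, conjTranspose_mul, conjTranspose_conjTranspose,
      hA.eq, Matrix.mul_assoc]
  obtain ⟨V, hV, hV', hCV⟩ := exists_sorted_eigenbasis hC
  obtain ⟨U, hU, hU', hAU⟩ := exists_sorted_eigenbasis hA
  have hQ : (X * V)ᴴ * (X * V) = 1 := by
    rw [conjTranspose_mul, Matrix.mul_assoc, ← Matrix.mul_assoc Xᴴ, hXX, Matrix.one_mul, hV]
  have hAQ : A * (X * V) = X * V * diagonal fun i => (sortedEig hC i : ℂ) := by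
    rw [Matrix.mul_assoc X, ← hCV, ← Matrix.mul_assoc X, ← hAX, Matrix.mul_assoc]
  have hcompl : ∀ (j : Fin p) (w : Matrix (Fin n) (Fin 1) ℂ), (X * V)ᴴ * w = 0 →
      sortedEig hC j * nsq w ≤ qf A w := by
    intro j w hw
    have hXw : Xᴴ * w = 0 := by
      rw [← Matrix.one_mul (Xᴴ * w), ← hV', Matrix.mul_assoc, ← Matrix.mul_assoc Vᴴ,
        ← conjTranspose_mul, hw, Matrix.mul_zero]
    have := hmin'.second_order_rank_one hA (lam := 0) (by rw [hH]; simp) hXw (colMat V j)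
    rw [nsq_mul hXX, qf_mul, qf_of_eigen (mul_colMat_of_eigen hCV j), nsq_colMat hV] at this
    linarith
  have heig : ∀ j : Fin p, sortedEig hC j = sortedEig hA (Fin.castLE hpn j) := by
    intro j
    have hjp : (j : ℕ) + 1 ≤ p := j.2
    refine le_antisymm ?_ ?_
    · refine le_of_eigen_compare j.2.le hA
        (submatrix_isometry hU (Fin.castLE_injective (hjp.trans hpn)))
        (submatrix_eigen hAU _) hQ hAQ
        (fun i => sortedEig_monotone hA (Fin.le_def.2 (Nat.le_of_lt_succ i.2)))
        (fun i hi => sortedEig_monotone hC (Fin.le_def.2 hi)) (hcompl j)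
    · refine le_of_eigen_compare (j.2.le.trans hpn) hA
        (submatrix_isometry hQ (Fin.castLE_injective hjp))
        (submatrix_eigen hAQ _) hU hAU
        (fun i => sortedEig_monotone hC (Fin.le_def.2 (Nat.le_of_lt_succ i.2)))
        (fun i hi => sortedEig_monotone hA (Fin.le_def.2 hi)) fun w hw => ?_
      have hw0 : w = 0 := by
        rw [← Matrix.one_mul w, ← hU', Matrix.mul_assoc, hw, Matrix.mul_zero]
      simp [hw0, nsq, qf]
  refine ⟨X * V, V, hQ, ?_, hV, hV', ?_⟩
  · simp only [hAQ, heig]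
  · rw [Matrix.mul_assoc, hV', Matrix.mul_one]
end
end

section
/- Let A ∈ ℂ^{n×n} be a negative definite Hermitian matrix and μ > |λ_min(A)|. Suppose X = (X_1, …, X_k) ∈ ℂ^{n×p} with block sizes p_1 + … + p_k = p satisfies: each X_i = U_i Σ_i V_i^* with U_i ∈ ℂ^{n×p_i}, V_i ∈ ℂ^{p_i×p_i} unitary, X_i ∈ OB(n, p_i); U = (U_1, …, U_k) satisfies U*U = I and every column of U_i is an eigenvector of A with eigenvalue λ_{ij}; and Σ_i = diag(σ_{i1}, …, σ_{i p_i}) where, with r_i = rank(X_i), σ_{ij} = sqrt(p_i/r_i − (λ_{ij} − (1/r_i) Σ_{l=1}^{r_i} λ_{il})/μ) for j ≤ r_i and σ_{ij} = 0 for j > r_i. Then X is a stationary point of qTPM: setting D = diag(d_1 I_{p_1}, …, d_k I_{p_k}) with d_i = −(μ p_i + Σ_{j=1}^{r_i} λ_{ij})/r_i, one has AX + μ X(X*X) + XD = 0 and X ∈ OB(n,p). -/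
open Matrix Finset

noncomputable section

/-- If a factorization `U Σ V` with diagonal `Σ` has rank `r` and the entries of `Σ` from the
index `r` on vanish, then the first `r` diagonal entries do not vanish. -/
theorem diagonal_entry_ne_zero_of_rank_eq {n p r : ℕ} (U : Matrix (Fin n) (Fin p) ℂ)
    (s : Fin p → ℂ) (W : Matrix (Fin p) (Fin p) ℂ)
    (hrank : (U * Matrix.diagonal s * W).rank = r)
    (h0 : ∀ j : Fin p, r ≤ (j : ℕ) → s j = 0) (j : Fin p) (hj : (j : ℕ) < r) : s j ≠ 0 := by
  intro hs
  have h1 : r ≤ (Matrix.diagonal s).rank := hrank ▸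
    (Matrix.rank_mul_le_left _ _).trans (Matrix.rank_mul_le_right _ _)
  classical
  rw [Matrix.rank_diagonal, Fintype.card_subtype] at h1
  have h2 : (Finset.univ.filter (fun i => s i ≠ 0)).card ≤ ((Finset.range r).erase j).card := by
    refine Finset.card_le_card_of_injOn (fun i : Fin p => (i : ℕ)) ?_
      (fun a _ b _ h => Fin.ext h)
    intro i hi
    have hi' : s i ≠ 0 := by simpa using hi
    simp only [Finset.coe_erase, Finset.coe_range, Set.mem_sdiff, Set.mem_Iio,
      Set.mem_singleton_iff]
    refine ⟨not_le.1 fun h => hi' (h0 i h), fun h => hi' ?_⟩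
    rw [Fin.ext h, hs]
  rw [Finset.card_erase_of_mem (Finset.mem_range.2 hj), Finset.card_range] at h2
  omega

/-- A matrix `U S W` with orthonormal columns of `U` that are eigenvectors of `A`, diagonal `S`
and unitary `W` commuting with the diagonal matrix `D` satisfies the stationarity equation as soon
as the scalar equation holds for every diagonal entry of `S`. -/
theorem stationary_of_scalar_equation {m ι : Type*} [Fintype m] [Fintype ι] [DecidableEq ι]
    (A : Matrix m m ℂ) (U : Matrix m ι ℂ) (W : Matrix ι ι ℂ) (l d : ι → ℂ) (s : ι → ℝ) (μ : ℂ)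
    (hU : Uᴴ * U = 1) (hW : W * Wᴴ = 1) (hAU : A * U = U * Matrix.diagonal l)
    (hWD : W * Matrix.diagonal d = Matrix.diagonal d * W)
    (hs : ∀ c, l c * s c + μ * (s c * s c * s c) + s c * d c = 0)
    (X : Matrix m ι ℂ) (hX : X = U * Matrix.diagonal (fun c => (s c : ℂ)) * W) :
    A * X + μ • (X * (Xᴴ * X)) + X * Matrix.diagonal d = 0 := by
  set S : Matrix ι ι ℂ := Matrix.diagonal (fun c => (s c : ℂ)) with hS
  have hSh : Sᴴ = S := by
    rw [hS, Matrix.diagonal_conjTranspose]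
    congr 1
    funext c
    simp
  have h1 : A * X = U * (Matrix.diagonal l * S) * W := by
    rw [hX, ← Matrix.mul_assoc, ← Matrix.mul_assoc, hAU, Matrix.mul_assoc U]
  have h2 : X * (Xᴴ * X) = U * (S * S * S) * W := by
    rw [hX, Matrix.conjTranspose_mul, Matrix.conjTranspose_mul, hSh]
    calc U * S * W * (Wᴴ * (S * Uᴴ) * (U * S * W))
        = U * S * (W * Wᴴ) * S * (Uᴴ * U) * S * W := by simp only [Matrix.mul_assoc]
      _ = U * (S * S * S) * W := by
        rw [hU, hW]
        simp only [Matrix.mul_assoc, Matrix.mul_one]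
  have h3 : X * Matrix.diagonal d = U * (S * Matrix.diagonal d) * W := by
    rw [hX, Matrix.mul_assoc, hWD]
    simp only [Matrix.mul_assoc]
  have h4 : Matrix.diagonal l * S + μ • (S * S * S) + S * Matrix.diagonal d = 0 := by
    simp only [hS, Matrix.diagonal_mul_diagonal, ← Matrix.diagonal_smul, Matrix.diagonal_add]
    rw [Matrix.diagonal_eq_zero]
    funext c
    simpa using hs c
  rw [h1, h2, h3]
  calc _ = U * (Matrix.diagonal l * S + μ • (S * S * S) + S * Matrix.diagonal d) * W := by
        simp only [Matrix.mul_add, Matrix.add_mul, Matrix.mul_smul, Matrix.smul_mul]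
    _ = 0 := by rw [h4, Matrix.mul_zero, Matrix.zero_mul]

/-- converse direction for qTPM stationary points.  If a block matrix
`X = (X_1, …, X_k)` (with columns indexed by `Σ i, Fin (pp i)`, block sizes summing to
`p`) satisfies the structural conditions of the qTPM stationary point theorem, then it is
a stationary point of qTPM: with `D = diag(d_1 I_{p_1}, …, d_k I_{p_k})`,
`d_i = −(μ p_i + Σ_{j=1}^{r_i} λ_{ij})/r_i`, one has `AX + μ X(X*X) + XD = 0` and
`X ∈ OB(n,p)`. -/
theorem qTPM_stationary_structure_converse {n : ℕ} (hn : 0 < n)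
    (A : Matrix (Fin n) (Fin n) ℂ) (hA : A.IsHermitian)
    (hneg : ∀ z : Fin n → ℂ, z ≠ 0 → (star z ⬝ᵥ A.mulVec z).re < 0)
    (μ : ℝ) (hμ : |⨅ i, hA.eigenvalues i| < μ)
    (k : ℕ) (hk : 0 < k) (pp r : Fin k → ℕ)
    (hpp : ∀ i, 0 < pp i)
    (U : (i : Fin k) → Matrix (Fin n) (Fin (pp i)) ℂ)
    (σ : (i : Fin k) → Fin (pp i) → ℝ)
    (V : (i : Fin k) → Matrix (Fin (pp i)) (Fin (pp i)) ℂ)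
    (X : (i : Fin k) → Matrix (Fin n) (Fin (pp i)) ℂ)
    (lam : (i : Fin k) → Fin (pp i) → ℝ)
    (hX : ∀ i, X i = U i * Matrix.diagonal (fun j => (σ i j : ℂ)) * (V i)ᴴ)
    (hrank : ∀ i, (X i).rank = r i)
    (hV : ∀ i, (V i)ᴴ * V i = 1) (hV2 : ∀ i, V i * (V i)ᴴ = 1)
    (hOBi : ∀ i j, ((X i)ᴴ * X i) j j = 1)
    (Uc : Matrix (Fin n) (Σ i : Fin k, Fin (pp i)) ℂ)
    (hUc : ∀ (a : Fin n) (c : Σ i : Fin k, Fin (pp i)), Uc a c = U c.1 a c.2)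
    (hUcU : Ucᴴ * Uc = 1)
    (heig : ∀ i (j : Fin (pp i)),
      A.mulVec (fun a => U i a j) = (lam i j : ℂ) • (fun a => U i a j))
    (hσ : ∀ i (j : Fin (pp i)), (j : ℕ) < r i →
      σ i j = Real.sqrt ((pp i : ℝ) / (r i : ℝ) -
        (lam i j - (∑ l ∈ Finset.univ.filter (fun l : Fin (pp i) => (l : ℕ) < r i),
          lam i l) / (r i : ℝ)) / μ))
    (hσ0 : ∀ i (j : Fin (pp i)), r i ≤ (j : ℕ) → σ i j = 0)
    (Xc : Matrix (Fin n) (Σ i : Fin k, Fin (pp i)) ℂ)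
    (hXc : ∀ (a : Fin n) (c : Σ i : Fin k, Fin (pp i)), Xc a c = X c.1 a c.2) :
    A * Xc + (μ : ℂ) • (Xc * (Xcᴴ * Xc))
      + Xc * Matrix.diagonal (fun c : Σ i : Fin k, Fin (pp i) =>
          ((-((μ * (pp c.1 : ℝ) +
            ∑ j ∈ Finset.univ.filter (fun j : Fin (pp c.1) => (j : ℕ) < r c.1), lam c.1 j) /
            (r c.1 : ℝ)) : ℝ) : ℂ)) = 0 ∧
    ∀ c, (Xcᴴ * Xc) c c = 1 := by
  have hμ0 : μ ≠ 0 := ((abs_nonneg _).trans_lt hμ).ne'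
  refine ⟨?_, fun c => ?_⟩
  · have hscalar : ∀ i (j : Fin (pp i)), lam i j * σ i j + μ * (σ i j * σ i j * σ i j)
        + σ i j * -((μ * (pp i : ℝ) +
            ∑ l ∈ Finset.univ.filter (fun l : Fin (pp i) => (l : ℕ) < r i), lam i l) /
            (r i : ℝ)) = 0 := by
      intro i j
      rcases le_or_gt (r i) j with hj | hj
      · simp [hσ0 i j hj]
      have hne : σ i j ≠ 0 := by
        have := diagonal_entry_ne_zero_of_rank_eq (U i) (fun j => (σ i j : ℂ)) (V i)ᴴ
          (hX i ▸ hrank i) (fun j hj => by simp [hσ0 i j hj]) j hj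
        exact_mod_cast this
      have hr : (r i : ℝ) ≠ 0 := by
        have : r i ≠ 0 := by omega
        exact_mod_cast this
      have hsq := hσ i j hj
      have hpos := Real.sqrt_ne_zero'.1 (hsq ▸ hne)
      have hmul := Real.mul_self_sqrt hpos.le
      rw [← hsq] at hmul
      rw [hmul]
      field_simp
      ring
    refine stationary_of_scalar_equation A Uc (Matrix.blockDiagonal' fun i => (V i)ᴴ)
      (fun c => (lam c.1 c.2 : ℂ)) _ (fun c => σ c.1 c.2) μ hUcU ?_ ?_ ?_ ?_ Xc ?_
    · rw [Matrix.blockDiagonal'_conjTranspose, ← Matrix.blockDiagonal'_mul]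
      simp only [Matrix.conjTranspose_conjTranspose, hV]
      exact Matrix.blockDiagonal'_one
    · ext a c
      rw [Matrix.mul_diagonal, hUc, mul_comm]
      have := congrFun (heig c.1 c.2) a
      simpa [Matrix.mul_apply, Matrix.mulVec, dotProduct, hUc] using this
    · ext a c
      rw [Matrix.mul_diagonal, Matrix.diagonal_mul, mul_comm]
      obtain ⟨i, a⟩ := a
      obtain ⟨j, c⟩ := c
      by_cases h : i = j
      · subst h
        rfl
      · rw [Matrix.blockDiagonal'_apply_ne _ _ _ h, mul_zero, mul_zero]
    · intro c
      exact_mod_cast hscalar c.1 c.2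
    · ext a ⟨i, j⟩
      rw [hXc, hX, Matrix.mul_apply, Matrix.mul_apply, Fintype.sum_sigma,
        Finset.sum_eq_single i]
      · simp [Matrix.mul_diagonal, hUc]
      · intro l _ hl
        refine Finset.sum_eq_zero fun x _ => ?_
        rw [Matrix.blockDiagonal'_apply_ne _ _ _ hl, mul_zero]
      · simp
  · simpa [Matrix.mul_apply, hXc] using hOBi c.1 c.2
end
end
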